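/- arXiv:2406.16558 — 10 statements merged into one kernel-verified Lean document; each statement's English description precedes it below -/
import Mathlib

section
/- Let n ≥ 5 and let k be an integer with 2 ≤ k ≤ n−3. Then for every permutation σ ∈ S_n, the induced endomorphism ⋀^k ρ(σ) of the k-th exterior power ⋀^k V_n of the standard representation has 1 as an eigenvalue; that is, the Specht module S^{(n−k,1^k)} is unisingular. -/
open Polynomial

noncomputable section

/-- The standard representation of `S_n`: the subspace `V_n` of `ℂ^n` of vectors with
coordinate sum zero (the Specht module `S^{(n-1,1)}`). -/
def Vn (n : ℕ) : Submodule ℂ (Fin n → ℂ) :=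
  LinearMap.ker (∑ i : Fin n, (LinearMap.proj i : (Fin n → ℂ) →ₗ[ℂ] ℂ))

/-- The endomorphism `ρ(σ)` of the standard representation induced by `v ↦ v ∘ σ⁻¹`. -/
def rho {n : ℕ} (σ : Equiv.Perm (Fin n)) : Vn n →ₗ[ℂ] Vn n :=
  (LinearMap.funLeft ℂ ℂ ⇑σ⁻¹).restrict (p := Vn n) (q := Vn n) fun v hv => by
    simp only [Vn, LinearMap.mem_ker, LinearMap.sum_apply, LinearMap.proj_apply,
      LinearMap.funLeft_apply] at hv ⊢
    rw [Equiv.sum_comp σ⁻¹ v]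
    exact hv

/-- The linear map functorially induced on the `k`-th exterior power `⋀[R]^k M`. -/
def extPowMap {R M : Type*} [CommRing R] [AddCommGroup M] [Module R M] (k : ℕ)
    (f : M →ₗ[R] M) : ⋀[R]^k M →ₗ[R] ⋀[R]^k M :=
  (ExteriorAlgebra.map f).toLinearMap.restrict (p := ⋀[R]^k M) (q := ⋀[R]^k M) fun x hx => by
    have h : Submodule.map (ExteriorAlgebra.map f).toLinearMap (⋀[R]^k M) ≤ ⋀[R]^k M := by
      rw [← ExteriorAlgebra.ιMulti_span_fixedDegree, Submodule.map_span, Submodule.span_le]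
      rintro y ⟨z, ⟨m, rfl⟩, rfl⟩
      exact Submodule.subset_span ⟨f ∘ m, (ExteriorAlgebra.map_apply_ιMulti f m).symm⟩
    exact h ⟨x, hx, rfl⟩

end

/-- Any value between the extreme sums is the sum of a `k`-subset of `{0, …, N - 1}`. -/
theorem exists_subset_range_sum_eq (N : ℕ) : ∀ k s : ℕ, k ≤ N → s ≤ k * (N - k) →
    ∃ T ⊆ Finset.range N, T.card = k ∧ ∑ i ∈ T, i = s + ∑ i ∈ Finset.range k, i := by
  induction N with
  | zero =>
    intro k s hk hs
    obtain rfl : k = 0 := by omega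
    exact ⟨∅, by simp, by simp, by simp; omega⟩
  | succ N ih =>
    intro k s hk hs
    by_cases h : k ≤ N ∧ s ≤ k * (N - k)
    · obtain ⟨T, hT, hc, hsum⟩ := ih k s h.1 h.2
      exact ⟨T, hT.trans (Finset.range_subset_range.2 N.le_succ), hc, hsum⟩
    · obtain ⟨j, rfl⟩ : ∃ j, k = j + 1 := by
        refine ⟨k - 1, ?_⟩
        rcases Nat.eq_zero_or_pos k with rfl | h0
        · simp_all
        · omega
      obtain ⟨d, rfl⟩ : ∃ d, N = j + d := ⟨N - j, by omega⟩
      have e1 : j + d + 1 - (j + 1) = d := by omega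
      rw [e1] at hs
      have hds : d ≤ s := by
        rcases d with _ | d
        · omega
        · by_contra hlt
          refine h ⟨by omega, ?_⟩
          have e2 : j + (d + 1) - (j + 1) = d := by omega
          rw [e2]
          nlinarith
      obtain ⟨T, hT, hc, hsum⟩ := ih j (s - d) (by omega) (by
        have e3 : j + d - j = d := by omega
        rw [e3, Nat.sub_le_iff_le_add]
        linarith)
      have hn : j + d ∉ T := fun hm => by simpa using hT hm
      refine ⟨insert (j + d) T, ?_, by rw [Finset.card_insert_of_notMem hn, hc], ?_⟩
      · intro x hx
        rcases Finset.mem_insert.1 hx with rfl | hx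
        · simp
        · have := Finset.mem_range.1 (hT hx)
          exact Finset.mem_range.2 (by omega)
      · rw [Finset.sum_insert hn, hsum, Finset.sum_range_succ]
        omega

theorem natCast_zmod_injOn (l : ℕ) : Set.InjOn (Nat.cast : ℕ → ZMod l) (Finset.range l) := by
  intro a ha b hb hab
  have ha := Finset.mem_range.1 ha
  have hb := Finset.mem_range.1 hb
  rwa [ZMod.natCast_eq_natCast_iff', Nat.mod_eq_of_lt ha, Nat.mod_eq_of_lt hb] at hab

/-- For `1 ≤ k ≤ l - 1`, every residue modulo `l` is the sum of a `k`-subset. -/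
theorem ZMod.exists_card_eq_sum_eq {l k : ℕ} (hk : 1 ≤ k) (hkl : k < l) (r : ZMod l) :
    ∃ T : Finset (ZMod l), T.card = k ∧ ∑ x ∈ T, x = r := by
  have : NeZero l := ⟨by omega⟩
  obtain ⟨d, rfl⟩ : ∃ d, l = k + d := ⟨l - k, by omega⟩
  set s : ZMod (k + d) := r - ((∑ i ∈ Finset.range k, i : ℕ) : ZMod (k + d)) with hs
  obtain ⟨T, hT, hc, hsum⟩ := exists_subset_range_sum_eq (k + d) k s.val (by omega) (by
    have := s.val_lt
    rw [Nat.add_sub_cancel_left]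
    nlinarith [mul_nonneg (show (0 : ℤ) ≤ k - 1 by omega) (show (0 : ℤ) ≤ d - 1 by omega)])
  have hinj := (natCast_zmod_injOn (k + d)).mono (Finset.coe_subset.2 hT)
  refine ⟨T.image Nat.cast, by rw [Finset.card_image_of_injOn hinj, hc], ?_⟩
  rw [Finset.sum_image hinj, ← Nat.cast_sum, hsum, Nat.cast_add, ZMod.natCast_zmod_val, hs,
    sub_add_cancel]

/-- For `2 ≤ k ≤ l - 3`, every residue modulo `l` is the sum of a `k`-subset of the nonzero
residues. -/
theorem ZMod.exists_card_eq_sum_eq_of_ne_zero {l k : ℕ} (hk : 2 ≤ k) (hkl : k + 3 ≤ l)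
    (r : ZMod l) : ∃ T : Finset (ZMod l), 0 ∉ T ∧ T.card = k ∧ ∑ x ∈ T, x = r := by
  have : NeZero l := ⟨by omega⟩
  obtain ⟨d, rfl⟩ : ∃ d, l = k + d + 3 := ⟨l - k - 3, by omega⟩
  set s : ZMod (k + d + 3) := r - ((k + ∑ i ∈ Finset.range k, i : ℕ) : ZMod (k + d + 3)) with hs
  obtain ⟨T, hT, hc, hsum⟩ := exists_subset_range_sum_eq (k + d + 2) k s.val (by omega) (by
    have := s.val_lt
    rw [show k + d + 2 - k = d + 2 by omega]
    nlinarith)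
  have hinj : Set.InjOn (fun i : ℕ => ((i + 1 : ℕ) : ZMod (k + d + 3))) T := by
    intro a ha b hb hab
    have ha := Finset.mem_range.1 (hT ha)
    have hb := Finset.mem_range.1 (hT hb)
    exact Nat.succ_injective (natCast_zmod_injOn _ (Finset.mem_coe.2 (Finset.mem_range.2 (by omega)))
      (Finset.mem_coe.2 (Finset.mem_range.2 (by omega))) hab)
  refine ⟨T.image fun i : ℕ => ((i + 1 : ℕ) : ZMod (k + d + 3)), ?_,
    by rw [Finset.card_image_of_injOn hinj, hc], ?_⟩
  · intro h0
    obtain ⟨i, hi, h⟩ := Finset.mem_image.1 h0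
    have hi := Finset.mem_range.1 (hT hi)
    have := Nat.le_of_dvd (by omega) ((ZMod.natCast_eq_zero_iff _ _).1 h)
    omega
  · rw [Finset.sum_image hinj, ← Nat.cast_sum, Finset.sum_add_distrib, hsum, Finset.sum_const, hc,
      smul_eq_mul, mul_one, Nat.cast_add, Nat.cast_add, ZMod.natCast_zmod_val, hs, Nat.cast_add]
    ring

/-- The sum of all residues is `2`-torsion. -/
theorem ZMod.sum_univ_add_self (l : ℕ) [NeZero l] : ∑ x : ZMod l, x + ∑ x : ZMod l, x = 0 := by
  nth_rewrite 2 [← Equiv.sum_comp (Equiv.neg (ZMod l))]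
  simp [← Finset.sum_add_distrib]

theorem AddChar.map_finset_sum {ι A M : Type*} [AddCommMonoid A] [CommMonoid M] (ψ : AddChar A M)
    (s : Finset ι) (f : ι → A) : ψ (∑ i ∈ s, f i) = ∏ i ∈ s, ψ (f i) := by
  classical
  induction s using Finset.induction_on with
  | empty => simp
  | insert i s hi ih =>
    rw [Finset.sum_insert hi, Finset.prod_insert hi, AddChar.map_add_eq_mul, ih]

/-- Some `k`-subset of `A` has weight product `z`. -/
def HasWeightSubset {ι : Type*} (w : ι → ℂ) (A : Finset ι) (k : ℕ) (z : ℂ) : Prop :=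
  ∃ T ⊆ A, T.card = k ∧ ∏ i ∈ T, w i = z

namespace HasWeightSubset

variable {ι : Type*} {w : ι → ℂ} {A B : Finset ι} {k m : ℕ} {y z : ℂ}

theorem empty (w : ι → ℂ) (A : Finset ι) : HasWeightSubset w A 0 1 :=
  ⟨∅, by simp, by simp, by simp⟩

theorem mono (h : HasWeightSubset w A k z) (hAB : A ⊆ B) : HasWeightSubset w B k z := by
  obtain ⟨T, hT, h⟩ := h
  exact ⟨T, hT.trans hAB, h⟩

theorem union [DecidableEq ι] (hA : HasWeightSubset w A k y) (hB : HasWeightSubset w B m z)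
    (hAB : Disjoint A B) : HasWeightSubset w (A ∪ B) (k + m) (y * z) := by
  obtain ⟨T, hT, rfl, rfl⟩ := hA
  obtain ⟨U, hU, rfl, rfl⟩ := hB
  have hd := hAB.mono hT hU
  exact ⟨T ∪ U, Finset.union_subset_union hT hU, Finset.card_union_of_disjoint hd,
    Finset.prod_union hd⟩

end HasWeightSubset

section Rotations

variable {Ω : Type} {l : Ω → ℕ} [∀ ω, NeZero (l ω)]

/-- The eigenvalues of a disjoint union of rotations. -/
noncomputable def rotationWeight (i : Σ ω, ZMod (l ω)) : ℂ := ZMod.stdAddChar i.2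

/-- The sum of all residues modulo `N`; it is nonzero exactly when `N` is even. -/
def residueSum (N : ℕ) [NeZero N] : ZMod N := ∑ x : ZMod N, x

theorem stdAddChar_residueSum_sq (N : ℕ) [NeZero N] :
    (ZMod.stdAddChar (residueSum N) : ℂ) ^ 2 = 1 := by
  rw [sq, ← AddChar.map_add_eq_mul, residueSum, ZMod.sum_univ_add_self, AddChar.map_zero_eq_one]

theorem stdAddChar_residueSum_eq_neg_one {N : ℕ} [NeZero N] (h : residueSum N ≠ 0) :
    (ZMod.stdAddChar (residueSum N) : ℂ) = -1 := by
  refine (sq_eq_one_iff.1 (stdAddChar_residueSum_sq N)).resolve_left fun h1 => h ?_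
  exact ZMod.injective_stdAddChar (h1.trans (AddChar.map_zero_eq_one _).symm)

theorem hasWeightSubset_of_finset {s : Finset Ω} {ω : Ω} (hω : ω ∈ s)
    (T : Finset (ZMod (l ω))) :
    HasWeightSubset (rotationWeight (l := l)) (s.sigma fun _ => Finset.univ) T.card
      (ZMod.stdAddChar (∑ x ∈ T, x)) := by
  refine ⟨T.map (Function.Embedding.sigmaMk ω), ?_, Finset.card_map _, ?_⟩
  · intro x hx
    obtain ⟨t, -, rfl⟩ := Finset.mem_map.1 hx
    simpa using hω
  · rw [Finset.prod_map, AddChar.map_finset_sum]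
    rfl

theorem hasWeightSubset_erase_of_finset [DecidableEq Ω] (ω : Ω)
    {T : Finset (ZMod (l ω))} (hT : 0 ∉ T) :
    HasWeightSubset (rotationWeight (l := l)) ((({ω} : Finset Ω).sigma fun _ => Finset.univ).erase
      ⟨ω, 0⟩) T.card (ZMod.stdAddChar (∑ x ∈ T, x)) := by
  refine ⟨T.map (Function.Embedding.sigmaMk ω), ?_, Finset.card_map _, ?_⟩
  · intro x hx
    obtain ⟨t, ht, rfl⟩ := Finset.mem_map.1 hx
    have : t ≠ 0 := fun h => hT (h ▸ ht)
    simpa using this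
  · rw [Finset.prod_map, AddChar.map_finset_sum]
    rfl

theorem two_le_of_residueSum_ne_zero {N : ℕ} [NeZero N] (h : residueSum N ≠ 0) : 2 ≤ N := by
  have := NeZero.pos N
  by_contra hN
  obtain rfl : N = 1 := by omega
  exact h (Subsingleton.elim _ _)

theorem hasWeightSubset_residue {s : Finset Ω} {ω : Ω} (hω : ω ∈ s) {k : ℕ} (hk : 1 ≤ k)
    (hkl : k < l ω) (r : ZMod (l ω)) :
    HasWeightSubset (rotationWeight (l := l)) (s.sigma fun _ => Finset.univ) k
      (ZMod.stdAddChar r) := by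
  obtain ⟨T, rfl, rfl⟩ := ZMod.exists_card_eq_sum_eq hk hkl r
  exact hasWeightSubset_of_finset hω T

theorem disjoint_sigma_singleton {s : Finset Ω} {ω : Ω} (hω : ω ∉ s) :
    Disjoint (({ω} : Finset Ω).sigma fun ω => (Finset.univ : Finset (ZMod (l ω))))
      (s.sigma fun _ => Finset.univ) := by
  rw [Finset.disjoint_left]
  rintro ⟨η, t⟩ h h'
  obtain rfl : η = ω := by simpa using h
  exact hω (Finset.mem_sigma.1 h').1

variable [DecidableEq Ω]

theorem hasWeightSubset_insert {s : Finset Ω} {ω : Ω} (hω : ω ∉ s) {k m : ℕ} {y z : ℂ}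
    (h : HasWeightSubset (rotationWeight (l := l)) (({ω} : Finset Ω).sigma fun _ => Finset.univ)
      k y)
    (h' : HasWeightSubset (rotationWeight (l := l)) (s.sigma fun _ => Finset.univ) m z) :
    HasWeightSubset (rotationWeight (l := l)) ((insert ω s).sigma fun _ => Finset.univ) (k + m)
      (y * z) := by
  refine (h.union h' (disjoint_sigma_singleton hω)).mono ?_
  rintro ⟨η, t⟩ hx
  simpa using hx

/-- Any number of elements can be taken from a union of rotations with weight product in `H`,
provided that `H` contains the weight products of the full rotations. -/
theorem exists_mem_hasWeightSubset (H : Submonoid ℂ) (s : Finset Ω)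
    (hH : ∀ ω ∈ s, (ZMod.stdAddChar (residueSum (l ω)) : ℂ) ∈ H) : ∀ k ≤ ∑ ω ∈ s, l ω,
    ∃ z ∈ H, HasWeightSubset (rotationWeight (l := l)) (s.sigma fun _ => Finset.univ) k z := by
  induction s using Finset.induction_on with
  | empty =>
    intro k hk
    obtain rfl : k = 0 := by simpa using hk
    exact ⟨1, H.one_mem, .empty _ _⟩
  | insert ω s hω ih =>
    intro k hk
    rw [Finset.sum_insert hω] at hk
    have key : ∀ j ≤ l ω, ∃ z ∈ H, HasWeightSubset (rotationWeight (l := l))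
        (({ω} : Finset Ω).sigma fun _ => Finset.univ) j z := by
      intro j hj
      rcases Nat.eq_zero_or_pos j with rfl | hj0
      · exact ⟨1, H.one_mem, .empty _ _⟩
      rcases hj.lt_or_eq with hlt | rfl
      · refine ⟨1, H.one_mem, ?_⟩
        simpa using hasWeightSubset_residue (Finset.mem_singleton_self ω) hj0 hlt 0
      · refine ⟨_, hH ω (Finset.mem_insert_self _ _), ?_⟩
        simpa [residueSum] using
          hasWeightSubset_of_finset (Finset.mem_singleton_self ω) (Finset.univ : Finset (ZMod (l ω)))
    obtain ⟨y, hy, hy'⟩ := key (min k (l ω)) (min_le_right _ _)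
    obtain ⟨z, hz, hz'⟩ := ih (fun η hη => hH η (Finset.mem_insert_of_mem hη))
      (k - min k (l ω)) (by omega)
    refine ⟨y * z, H.mul_mem hy hz, ?_⟩
    have := hasWeightSubset_insert hω hy' hz'
    rwa [Nat.add_sub_cancel' (min_le_left _ _)] at this

theorem exists_sq_eq_one_hasWeightSubset (s : Finset Ω) {k : ℕ} (hk : k ≤ ∑ ω ∈ s, l ω) :
    ∃ z : ℂ, z ^ 2 = 1 ∧
      HasWeightSubset (rotationWeight (l := l)) (s.sigma fun _ => Finset.univ) k z :=
  exists_mem_hasWeightSubset (MonoidHom.mker (powMonoidHom 2)) s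
    (fun _ _ => stdAddChar_residueSum_sq _) k hk

theorem hasWeightSubset_one_of_residueSum_eq_zero {s : Finset Ω}
    (hs : ∀ ω ∈ s, residueSum (l ω) = 0) {k : ℕ} (hk : k ≤ ∑ ω ∈ s, l ω) :
    HasWeightSubset (rotationWeight (l := l)) (s.sigma fun _ => Finset.univ) k 1 := by
  obtain ⟨z, hz, h⟩ := exists_mem_hasWeightSubset ⊥ s
    (fun ω hω => by rw [hs ω hω, AddChar.map_zero_eq_one]; exact Submonoid.one_mem _) k hk
  rwa [Submonoid.mem_bot.1 hz] at h

/-- A rotation of even length can be used to correct signs. -/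
theorem hasWeightSubset_of_residueSum_ne_zero {s : Finset Ω} {ω : Ω} (hω : ω ∈ s)
    (h : residueSum (l ω) ≠ 0) {k : ℕ} (hk : 1 ≤ k) (hks : k < ∑ ω ∈ s, l ω) {z : ℂ}
    (hz : z ^ 2 = 1) :
    HasWeightSubset (rotationWeight (l := l)) (s.sigma fun _ => Finset.univ) k z := by
  have hl := two_le_of_residueSum_ne_zero h
  rw [← Finset.add_sum_erase _ _ hω] at hks
  obtain ⟨y, hy, hy'⟩ := exists_sq_eq_one_hasWeightSubset (l := l) (s.erase ω)
    (k := k - min k (l ω - 1)) (by omega)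
  obtain ⟨r, hr⟩ : ∃ r : ZMod (l ω), ZMod.stdAddChar r = z * y := by
    have : (z * y) ^ 2 = 1 := by rw [mul_pow, hz, hy, one_mul]
    rcases sq_eq_one_iff.1 this with h1 | h1
    · exact ⟨0, by rw [h1, AddChar.map_zero_eq_one]⟩
    · exact ⟨residueSum (l ω), by rw [h1, stdAddChar_residueSum_eq_neg_one h]⟩
  have := hasWeightSubset_insert (Finset.notMem_erase ω s)
    (hasWeightSubset_residue (Finset.mem_singleton_self ω) (k := min k (l ω - 1)) (by omega)
      (by omega) r) hy'
  rwa [Nat.add_sub_cancel' (min_le_left _ _), Finset.insert_erase hω, hr, mul_assoc, ← sq, hy,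
    mul_one] at this

/-- A set of `k` eigenvalues with product `1`, avoiding the eigenvalue `1` of a shortest
rotation. -/
theorem exists_rotationWeight_prod_eq_one [Fintype Ω] {ω₀ : Ω} (hmin : ∀ ω, l ω₀ ≤ l ω) {k : ℕ}
    (hk : 2 ≤ k) (hk' : k + 3 ≤ ∑ ω, l ω) :
    ∃ T : Finset (Σ ω, ZMod (l ω)), ⟨ω₀, 0⟩ ∉ T ∧ T.card = k ∧
      ∏ i ∈ T, rotationWeight i = 1 := by
  have key : ∀ (T : Finset (ZMod (l ω₀))) (j : ℕ) (z : ℂ), 0 ∉ T →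
      HasWeightSubset (rotationWeight (l := l)) ((Finset.univ.erase ω₀).sigma fun _ => Finset.univ)
        j z → T.card + j = k → ZMod.stdAddChar (∑ x ∈ T, x) * z = 1 →
      ∃ T : Finset (Σ ω, ZMod (l ω)), ⟨ω₀, 0⟩ ∉ T ∧ T.card = k ∧
        ∏ i ∈ T, rotationWeight i = 1 := by
    intro T j z hT h hc hz
    have hd := disjoint_sigma_singleton (l := l) (Finset.notMem_erase ω₀ Finset.univ)
    obtain ⟨U, hU, hUc, hUp⟩ := (hasWeightSubset_erase_of_finset ω₀ hT).union h
      (hd.mono_left (Finset.erase_subset _ _))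
    refine ⟨U, fun h0 => ?_, hUc.trans hc, hUp.trans hz⟩
    simpa using hU h0
  have hsum := Finset.add_sum_erase Finset.univ l (Finset.mem_univ ω₀)
  set s := Finset.univ.erase ω₀
  have h0 : (0 : ZMod (l ω₀)) ∉ Finset.univ.erase 0 := by simp
  have hcard : (Finset.univ.erase (0 : ZMod (l ω₀))).card = l ω₀ - 1 := by simp
  have hres : ∑ x ∈ Finset.univ.erase (0 : ZMod (l ω₀)), x = residueSum (l ω₀) :=
    Finset.sum_erase _ rfl
  have hpos := NeZero.pos (l ω₀)
  rcases s.eq_empty_or_nonempty with hempty | ⟨η, hη⟩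
  · rw [hempty, Finset.sum_empty] at hsum
    obtain ⟨T, hT, hTc, hTs⟩ := ZMod.exists_card_eq_sum_eq_of_ne_zero hk
      (show k + 3 ≤ l ω₀ by omega) 0
    exact key T 0 1 hT (.empty _ _) hTc (by simp [hTs])
  have hle : l ω₀ ≤ ∑ ω ∈ s, l ω :=
    (hmin η).trans (Finset.single_le_sum (fun _ _ => Nat.zero_le _) hη)
  by_cases heven : ∃ ω ∈ s, residueSum (l ω) ≠ 0
  · obtain ⟨ω, hω, hne⟩ := heven
    by_cases hks : k < ∑ ω ∈ s, l ω
    · exact key ∅ k 1 (by simp)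
        (hasWeightSubset_of_residueSum_ne_zero hω hne (by omega) hks (one_pow 2)) (by simp) (by simp)
    · refine key _ (k - (l ω₀ - 1)) _ h0 (hasWeightSubset_of_residueSum_ne_zero hω hne
        (by omega) (by omega) (stdAddChar_residueSum_sq (l ω₀))) (by omega) ?_
      rw [hres, ← sq, stdAddChar_residueSum_sq]
  · push Not at heven
    by_cases hks : k ≤ ∑ ω ∈ s, l ω
    · exact key ∅ k 1 (by simp) (hasWeightSubset_one_of_residueSum_eq_zero heven hks) (by simp)
        (by simp)
    by_cases hr : residueSum (l ω₀) = 0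
    · refine key _ (k - (l ω₀ - 1)) 1 h0
        (hasWeightSubset_one_of_residueSum_eq_zero heven (by omega)) (by omega) ?_
      rw [hres, hr, AddChar.map_zero_eq_one, mul_one]
    · have hl := two_le_of_residueSum_ne_zero hr
      have hmem : residueSum (l ω₀) ∈ Finset.univ.erase (0 : ZMod (l ω₀)) := by simpa using hr
      refine key ((Finset.univ.erase 0).erase (residueSum (l ω₀))) (k - (l ω₀ - 2)) 1 (by simp)
        (hasWeightSubset_one_of_residueSum_eq_zero heven (by omega)) ?_ ?_
      · rw [Finset.card_erase_of_mem hmem, hcard]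
        omega
      · have := Finset.add_sum_erase _ (fun x => x) hmem
        rw [hres, add_eq_left] at this
        rw [this, AddChar.map_zero_eq_one, mul_one]

end Rotations

theorem exteriorPower.ιMulti_ne_zero_of_linearIndependent {K E : Type*} [Field K] [AddCommGroup E]
    [Module K E] {k : ℕ} {v : Fin k → E} (hv : LinearIndependent K v) :
    exteriorPower.ιMulti K k v ≠ 0 := by
  have h := (exteriorPower.ιMulti_family_linearIndependent_field (n := k) hv).ne_zero
    (Set.powersetCard.ofFinEmbEquiv (RelEmbedding.refl _))
  rwa [exteriorPower.ιMulti_family, Equiv.symm_apply_apply] at h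

theorem extPowMap_ιMulti {R M : Type*} [CommRing R] [AddCommGroup M] [Module R M] {k : ℕ}
    (f : M →ₗ[R] M) (v : Fin k → M) :
    extPowMap k f (exteriorPower.ιMulti R k v) = exteriorPower.ιMulti R k (f ∘ v) :=
  Subtype.ext (ExteriorAlgebra.map_apply_ιMulti f v)

/-- A product of eigenvalues belonging to `k` linearly independent eigenvectors is an eigenvalue
on the `k`-th exterior power. -/
theorem hasEigenvalue_extPowMap_prod {K E ι : Type*} [Field K] [AddCommGroup E] [Module K E]
    (f : E →ₗ[K] E) {v : ι → E} {c : ι → K} (hf : ∀ i, f (v i) = c i • v i) {T : Finset ι}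
    (hv : LinearIndepOn K v (T : Set ι)) :
    Module.End.HasEigenvalue (extPowMap T.card f) (∏ i ∈ T, c i) := by
  let e := T.equivFin.symm
  have hli : LinearIndependent K fun j => v (e j) := hv.comp e e.injective
  refine Module.End.hasEigenvalue_of_hasEigenvector
    (x := exteriorPower.ιMulti K T.card fun j => v (e j)) ⟨?_, ?_⟩
  · rw [Module.End.mem_eigenspace_iff, extPowMap_ιMulti]
    have : (f ∘ fun j => v (e j)) = fun j => c (e j) • v (e j) := funext fun j => hf _
    rw [this, AlternatingMap.map_smul_univ, Equiv.prod_comp e fun i : T => c i,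
      Finset.prod_coe_sort]
  · exact exteriorPower.ιMulti_ne_zero_of_linearIndependent hli

/-- Correcting eigenvectors by multiples of a fixed vector moves them into the kernel of an
invariant functional. -/
theorem exists_eigenvectors_ker {K E ι : Type*} [Field K] [AddCommGroup E] [Module K E]
    (f : E →ₗ[K] E) (φ : E →ₗ[K] K) (hφ : ∀ x, φ (f x) = φ x) {v : ι → E} {c : ι → K}
    (hf : ∀ i, f (v i) = c i • v i) (hv : LinearIndependent K v) {i₀ : ι} (hi₀ : φ (v i₀) ≠ 0)
    {s : Set ι} (hs : i₀ ∉ s) :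
    ∃ w : ι → LinearMap.ker φ, (∀ i, f (w i) = c i • (w i : E)) ∧ LinearIndepOn K w s := by
  have hc : c i₀ = 1 := by
    have := hφ (v i₀)
    rw [hf, map_smul, smul_eq_mul] at this
    exact mul_right_cancel₀ hi₀ (by rw [this, one_mul])
  let P : E →ₗ[K] E := LinearMap.id - ((φ (v i₀))⁻¹ • φ).smulRight (v i₀)
  have hP : ∀ x, P x = x - ((φ (v i₀))⁻¹ * φ x) • v i₀ := fun x => rfl
  have hker : ∀ x, P x ∈ LinearMap.ker φ := fun x => by
    rw [LinearMap.mem_ker, hP, map_sub, map_smul, smul_eq_mul, mul_right_comm,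
      inv_mul_cancel₀ hi₀, one_mul, sub_self]
  have hcomm : ∀ x, f (P x) = P (f x) := fun x => by
    rw [hP, hP, hφ, map_sub, map_smul, hf, hc, one_smul]
  refine ⟨fun i => ⟨P (v i), hker _⟩, fun i => ?_, ?_⟩
  · change f (P (v i)) = c i • P (v i)
    rw [hcomm, hf, map_smul]
  · refine LinearIndependent.of_comp (LinearMap.ker φ).subtype ?_
    refine (hv.comp ((↑) : s → ι) Subtype.val_injective).map (f := P) ?_
    have hd := hv.disjoint_span_image (s := s) (t := {i₀}) (by simpa using hs)
    rw [Set.range_comp, Subtype.range_coe]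
    refine hd.mono_right fun x hx => ?_
    rw [LinearMap.mem_ker, hP, sub_eq_zero] at hx
    rw [Set.image_singleton, hx]
    exact Submodule.smul_mem _ _ (Submodule.mem_span_singleton_self _)

/-- A permutation of a finite type is a disjoint union of rotations `t ↦ t + 1` of `ZMod l`. -/
theorem Equiv.Perm.exists_equiv_sigma_zmod {α : Type} [Finite α] (σ : Equiv.Perm α) :
    ∃ (Ω : Type) (l : Ω → ℕ) (e : (Σ ω, ZMod (l ω)) ≃ α), (∀ ω, NeZero (l ω)) ∧
      ∀ ω t, σ (e ⟨ω, t⟩) = e ⟨ω, t + 1⟩ := by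
  let G := Subgroup.zpowers σ
  let e := (MulAction.selfEquivSigmaOrbits G α).trans
    (Equiv.sigmaCongrRight fun ω => MulAction.orbitZPowersEquiv σ ω.out)
  refine ⟨_, _, e.symm, fun ω => inferInstance, fun ω t => ?_⟩
  have h : ∀ t : ℤ, e.symm ⟨ω, t⟩ = (σ ^ t) ω.out := fun t => by
    change ((MulAction.orbitZPowersEquiv σ ω.out).symm t : α) = _
    rw [MulAction.orbitZPowersEquiv_symm_apply']
    rfl
  obtain ⟨t, rfl⟩ := ZMod.intCast_surjective t
  rw [h, ← Int.cast_one, ← Int.cast_add, h, add_comm, zpow_add, zpow_one, Equiv.Perm.mul_apply]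

theorem ZMod.linearIndependent_stdAddChar (N : ℕ) [NeZero N] :
    LinearIndependent ℂ fun j t : ZMod N => ZMod.stdAddChar (-(j * t)) := by
  rw [Fintype.linearIndependent_iff]
  intro g hg
  have : ZMod.dft g = 0 := by
    ext t
    simpa [ZMod.dft_apply, mul_comm] using congrFun hg t
  exact congrFun ((LinearEquiv.map_eq_zero_iff _).1 this)

/-- The permutation matrix of a disjoint union of rotations is diagonalized by additive
characters. -/
theorem exists_eigenvectors_funLeft {α Ω : Type} [Finite Ω]
    [DecidableEq Ω] {l : Ω → ℕ} [∀ ω, NeZero (l ω)]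
    (e : (Σ ω, ZMod (l ω)) ≃ α) (σ : Equiv.Perm α) (h : ∀ ω t, σ (e ⟨ω, t⟩) = e ⟨ω, t + 1⟩) :
    ∃ v : (Σ ω, ZMod (l ω)) → α → ℂ, LinearIndependent ℂ v ∧
      (∀ i, LinearMap.funLeft ℂ ℂ ⇑σ⁻¹ (v i) = ZMod.stdAddChar i.2 • v i) ∧
      ∀ ω η t, v ⟨ω, 0⟩ (e ⟨η, t⟩) = (Pi.single ω 1 : Ω → ℂ) η := by
  obtain ⟨L, hL⟩ : ∃ L : (∀ ω, ZMod (l ω) → ℂ) →ₗ[ℂ] (α → ℂ),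
      ∀ F ω t, L F (e ⟨ω, t⟩) = F ω t := by
    refine ⟨LinearMap.funLeft ℂ ℂ e.symm ∘ₗ
      (LinearEquiv.piCurry ℂ fun _ _ => ℂ).symm.toLinearMap, fun F ω t => ?_⟩
    change F (e.symm (e ⟨ω, t⟩)).1 (e.symm (e ⟨ω, t⟩)).2 = F ω t
    rw [Equiv.symm_apply_apply]
  let u : (Σ ω, ZMod (l ω)) → ∀ ω, ZMod (l ω) → ℂ :=
    fun i => Pi.single i.1 fun t => ZMod.stdAddChar (-(i.2 * t))
  have hu : LinearIndependent ℂ u :=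
    Pi.linearIndependent_single (fun ω (j t : ZMod (l ω)) => (ZMod.stdAddChar (-(j * t)) : ℂ))
      fun ω => ZMod.linearIndependent_stdAddChar (l ω)
  refine ⟨fun i => L (u i), hu.map' L ?_, ?_, ?_⟩
  · rw [LinearMap.ker_eq_bot']
    intro F hF
    ext ω t
    simpa [hF] using (hL F ω t).symm
  · rintro ⟨ω, j⟩
    ext x
    obtain ⟨⟨η, t⟩, rfl⟩ := e.surjective x
    have hinv : σ⁻¹ (e ⟨η, t⟩) = e ⟨η, t - 1⟩ := by
      rw [Equiv.Perm.inv_eq_iff_eq, h, sub_add_cancel]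
    rw [LinearMap.funLeft_apply, hinv, Pi.smul_apply]
    simp only [hL]
    by_cases hη : η = ω
    · subst hη
      simp only [u, Pi.single_eq_same, smul_eq_mul]
      rw [← AddChar.map_add_eq_mul]
      ring_nf
    · simp [u, Pi.single_eq_of_ne hη]
  · intro ω η t
    simp only [hL]
    by_cases hη : η = ω
    · subst hη
      simp [u]
    · simp [u, Pi.single_eq_of_ne hη]

/-- For `n ≥ 5` and `2 ≤ k ≤ n - 3`, every `σ ∈ S_n` has `1` as an eigenvalue on
`⋀^k V_n`; i.e. the Specht module `S^{(n-k,1^k)}` is unisingular. -/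
theorem specht_hook_unisingular (n k : ℕ) (hn : 5 ≤ n) (hk2 : 2 ≤ k) (hk : k ≤ n - 3)
    (σ : Equiv.Perm (Fin n)) :
    Module.End.HasEigenvalue (extPowMap k (rho σ)) (1 : ℂ) := by
  obtain ⟨Ω, l, e, _, he⟩ := σ.exists_equiv_sigma_zmod
  classical
  have : Finite Ω := Finite.of_injective (fun ω => e ⟨ω, 0⟩) fun ω η h =>
    congrArg Sigma.fst (e.injective h)
  have : Fintype Ω := Fintype.ofFinite Ω
  have : Nonempty Ω := ⟨(e.symm ⟨0, by omega⟩).1⟩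
  have hcard : ∑ ω, l ω = n := by
    simpa [ZMod.card] using Fintype.card_congr e
  obtain ⟨ω₀, hmin⟩ := Finite.exists_min l
  obtain ⟨T, hT, rfl, hprod⟩ := exists_rotationWeight_prod_eq_one hmin hk2 (by omega)
  obtain ⟨v, hv, hev, hv0⟩ := exists_eigenvectors_funLeft e σ he
  have hsum : ∀ x : Fin n → ℂ,
      (∑ i : Fin n, (LinearMap.proj i : (Fin n → ℂ) →ₗ[ℂ] ℂ)) x = ∑ i, x i := fun x => by
    simp only [LinearMap.sum_apply, LinearMap.proj_apply]
  obtain ⟨w, hw, hwT⟩ := exists_eigenvectors_ker (LinearMap.funLeft ℂ ℂ ⇑σ⁻¹) _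
    (fun x => by rw [hsum, hsum]; exact Equiv.sum_comp σ⁻¹ x) hev hv (i₀ := ⟨ω₀, 0⟩) (by
      rw [hsum, ← Equiv.sum_comp e, Fintype.sum_sigma]
      simp only [hv0, Finset.sum_const, Finset.card_univ, ZMod.card, nsmul_eq_mul]
      simp [Pi.single_apply, NeZero.ne]) (s := T) hT
  rw [← hprod]
  exact hasEigenvalue_extPowMap_prod (rho σ) (fun i => Subtype.ext (hw i)) hwT
end

section
/- Let n ≥ 7 and let k be an integer with ⌊(n+1)/2⌋ ≤ k ≤ n−3. Then for every permutation σ ∈ S_n, the induced endomorphism ⋀^k ρ(σ) of ⋀^k V_n has 1 as an eigenvalue; that is, the Specht module S^{(n−k,1^k)} is unisingular. -/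
open Polynomial

/-- Decomposable `k`-vectors built from linearly independent eigenvectors are eigenvectors. -/
theorem hasEigenvalue_extPowMap {K V I : Type*} [Field K] [AddCommGroup V] [Module K V]
    (f : Module.End K V) {v : I → V} (hv : LinearIndependent K v) {μ : I → K}
    (hf : ∀ i, f (v i) = μ i • v i) (s : Finset I) :
    Module.End.HasEigenvalue (extPowMap s.card f) (∏ i ∈ s, μ i) := by
  classical
  let : LinearOrder I := linearOrderOfSTO WellOrderingRel
  have hli := exteriorPower.ιMulti_family_linearIndependent_field s.card hv
  have hne := hli.ne_zero ⟨s, rfl⟩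
  refine Module.End.hasEigenvalue_of_hasEigenvector
    (x := exteriorPower.ιMulti_family K s.card v ⟨s, rfl⟩) ⟨?_, hne⟩
  rw [Module.End.mem_eigenspace_iff]
  apply Subtype.ext
  have hprod : ∏ i ∈ s, μ i = ∏ j : Fin s.card, μ (s.orderEmbOfFin rfl j) := by
    rw [← Finset.prod_coe_sort]
    exact (Equiv.prod_comp (s.orderIsoOfFin rfl).toEquiv (fun i : s => μ i)).symm
  change ExteriorAlgebra.map f
      (ExteriorAlgebra.ιMulti K s.card (v ∘ s.orderEmbOfFin rfl)) =
    (∏ i ∈ s, μ i) • ExteriorAlgebra.ιMulti K s.card (v ∘ s.orderEmbOfFin rfl)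
  rw [ExteriorAlgebra.map_apply_ιMulti, hprod, ← AlternatingMap.map_smul_univ]
  congr 1
  funext j
  simp [hf]

theorem exists_le_map_eq_of_le_map {α β : Type*} (f : α → β) (s : Multiset α) :
    ∀ t ≤ s.map f, ∃ u ≤ s, u.map f = t := by
  classical
  induction s using Multiset.induction with
  | empty => intro t ht; exact ⟨0, le_rfl, by simpa using (Multiset.le_zero.1 ht).symm⟩
  | cons a s ih =>
    intro t ht
    rw [Multiset.map_cons] at ht
    by_cases h : f a ∈ t
    · obtain ⟨t', rfl⟩ := Multiset.exists_cons_of_mem h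
      obtain ⟨u, hu, rfl⟩ := ih t' ((Multiset.cons_le_cons_iff _).1 ht)
      exact ⟨a ::ₘ u, Multiset.cons_le_cons _ hu, by simp⟩
    · obtain ⟨u, hu, rfl⟩ := ih t ((Multiset.le_cons_of_notMem h).1 ht)
      exact ⟨u, hu.trans (Multiset.le_cons_self _ _), rfl⟩

/-- A multiset of nonzero scalars that contains `1` and is closed under inversion has
submultisets of every smaller size with product `1`. -/
theorem exists_le_card_eq_prod_eq_one {K : Type*} [Field K] (S : Multiset K)
    (h0 : ∀ a ∈ S, a ≠ 0) (h1 : (1 : K) ∈ S) (hinv : S.map (·⁻¹) = S) {k : ℕ}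
    (hk : k < S.card) :
    ∃ T ≤ S, T.card = k ∧ T.prod = 1 := by
  classical
  induction hN : S.card using Nat.strong_induction_on generalizing S k with
  | _ N ih =>
  subst hN
  have hmem : ∀ a ∈ S, a⁻¹ ∈ S := fun a ha => by
    rw [← hinv]; exact Multiset.mem_map_of_mem _ ha
  by_cases hpair : ∃ a, a ≠ 1 ∧ a ::ₘ {a⁻¹} ≤ S
  · obtain ⟨a, ha1, ha⟩ := hpair
    obtain ⟨S', rfl⟩ := Multiset.le_iff_exists_add.1 ha
    have ha0 : a ≠ 0 := h0 a (by simp)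
    have h1' : (1 : K) ∈ S' := by
      simp only [Multiset.mem_add, Multiset.mem_cons, Multiset.mem_singleton] at h1
      rcases h1 with (h | h) | h
      · exact absurd h.symm ha1
      · exact absurd (inv_eq_one.1 h.symm) ha1
      · exact h
    have hinv' : S'.map (·⁻¹) = S' := by
      have hswap : (a ::ₘ {a⁻¹} : Multiset K).map (·⁻¹) = a ::ₘ {a⁻¹} := by
        simpa using Multiset.pair_comm a⁻¹ a
      rw [Multiset.map_add, hswap] at hinv
      exact add_left_cancel hinv
    have h0' : ∀ b ∈ S', b ≠ 0 := fun b hb => h0 b (Multiset.mem_add.2 (Or.inr hb))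
    have hcard : (a ::ₘ {a⁻¹} + S').card = S'.card + 2 := by
      simp only [Multiset.card_add, Multiset.card_cons, Multiset.card_singleton]
      omega
    rw [hcard] at hk ih
    have hpos : 0 < S'.card := Multiset.card_pos_iff_exists_mem.2 ⟨_, h1'⟩
    by_cases hlt : k < S'.card
    · obtain ⟨T, hT, hTc, hTp⟩ := ih S'.card (by omega) S' h0' h1' hinv' hlt rfl
      exact ⟨T, hT.trans (Multiset.le_add_left _ _), hTc, hTp⟩
    · by_cases hk1 : k = 1
      · exact ⟨{1}, Multiset.singleton_le.2 h1, by simp [hk1], by simp⟩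
      · obtain ⟨T, hT, hTc, hTp⟩ := ih S'.card (by omega) S' h0' h1' hinv'
          (k := k - 2) (by omega) rfl
        refine ⟨a ::ₘ {a⁻¹} + T, by gcongr, ?_, ?_⟩
        · simp only [Multiset.card_add, Multiset.card_cons, Multiset.card_singleton]
          omega
        · simp [hTp, ha0]
  · push Not at hpair
    have hneg : ∀ a ∈ S, a ≠ 1 → a = -1 := fun a ha ha1 => by
      by_cases h : a = a⁻¹
      · refine (mul_self_eq_one_iff.1 ?_).resolve_left ha1
        nth_rewrite 2 [h]
        exact mul_inv_cancel₀ (h0 a ha)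
      · refine absurd ((Multiset.le_iff_subset (by simpa using h)).2 ?_) (hpair a ha1)
        simp [Multiset.cons_subset, ha, hmem a ha]
    have hcount : S.card - 1 ≤ S.count 1 := by
      by_cases hall : ∀ a ∈ S, a = 1
      · rw [Multiset.eq_replicate_card.2 hall]; simp
      · push Not at hall
        obtain ⟨a, ha, ha1⟩ := hall
        obtain ⟨S', rfl⟩ := Multiset.exists_cons_of_mem ha
        have hone : ∀ b ∈ S', 1 = b := by
          intro b hb
          by_contra hb1
          have hba : b = a⁻¹ := by
            rw [hneg b (Multiset.mem_cons_of_mem hb) (Ne.symm hb1), hneg a ha ha1, inv_neg_one]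
          exact hpair a ha1
            (Multiset.cons_le_cons a (Multiset.singleton_le.2 (hba ▸ hb)))
        rw [Multiset.count_cons_of_ne ha1.symm, Multiset.count_eq_card.2 hone]
        simp
    refine ⟨Multiset.replicate k 1, Multiset.le_count_iff_replicate_le.1 (by omega), by simp,
      by simp⟩

/-- The sums of `a`-element subsets of `{1, …, a + b}` fill an interval. -/
theorem exists_subset_Icc_card_sum (a b s : ℕ) (hs : s ≤ a * b) :
    ∃ S ⊆ Finset.Icc 1 (a + b), S.card = a ∧ 2 * ∑ i ∈ S, i = a * (a + 1) + 2 * s := by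
  induction hm : a + b generalizing a b s with
  | zero =>
    obtain ⟨rfl, rfl⟩ : a = 0 ∧ b = 0 := by omega
    exact ⟨∅, by simp, by simp, by simp at hs ⊢; exact hs⟩
  | succ m ih =>
    have hmono : Finset.Icc 1 m ⊆ Finset.Icc 1 (m + 1) := Finset.Icc_subset_Icc_right (by omega)
    by_cases hb : 0 < b ∧ s ≤ a * (b - 1)
    · obtain ⟨S, hS, hc, hsum⟩ := ih a (b - 1) s hb.2 (by omega)
      exact ⟨S, hS.trans hmono, hc, hsum⟩
    · rcases a with _ | a
      · simp only [zero_mul, Nat.le_zero] at hs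
        exact ⟨∅, by simp, by simp, by simp [hs]⟩
      · have hbs : b ≤ s := by
          rcases b with _ | b
          · omega
          · simp only [not_and, not_le, Nat.add_sub_cancel] at hb
            have := hb (by omega)
            nlinarith
        have hle : s - b ≤ a * b := by
          rw [add_mul, one_mul] at hs; omega
        obtain ⟨S, hS, hc, hsum⟩ := ih a b (s - b) hle (by omega)
        have hnot : m + 1 ∉ S := fun h => by have := Finset.mem_Icc.1 (hS h); omega
        refine ⟨insert (m + 1) S, ?_, ?_, ?_⟩
        · exact Finset.insert_subset (by simp) (hS.trans hmono)
        · rw [Finset.card_insert_of_notMem hnot, hc]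
        · rw [Finset.sum_insert hnot, mul_add, hsum]
          obtain ⟨t, rfl⟩ := Nat.exists_eq_add_of_le hbs
          rw [Nat.add_sub_cancel_left, ← hm]
          ring

theorem exists_subset_Icc_card_dvd_sum {n k : ℕ} (hk2 : 2 ≤ k) (hk : k + 3 ≤ n) :
    ∃ S ⊆ Finset.Icc 1 (n - 1), S.card = k ∧ n ∣ ∑ i ∈ S, i := by
  obtain ⟨c, hc⟩ : ∃ c, 2 * c = k * (k + 1) := (Nat.even_mul_succ_self k).two_dvd.imp
    fun c h => h.symm
  obtain ⟨b, rfl⟩ : ∃ b, n = k + b + 1 := ⟨n - 1 - k, by omega⟩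
  set N := k + b + 1 with hN
  have hmod : c % N < N := Nat.mod_lt _ (by omega)
  have hdiv := Nat.div_add_mod c N
  obtain ⟨S, hS, hcard, hsum⟩ := exists_subset_Icc_card_sum k b ((N - c % N) % N) (by
    have h1 : (N - c % N) % N < N := Nat.mod_lt _ (by omega)
    have h2 : k + b ≤ k * b := by
      have hb : 2 ≤ b := by omega
      nlinarith
    omega)
  refine ⟨S, by simpa [hN] using hS, hcard, ?_⟩
  have hS' : ∑ i ∈ S, i = c + (N - c % N) % N := by omega
  rw [hS', Nat.dvd_iff_mod_eq_zero, Nat.add_mod, Nat.mod_mod]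
  by_cases h : c % N = 0
  · simp [h]
  · rw [Nat.mod_eq_of_lt (a := N - c % N) (by omega), Nat.add_sub_cancel' hmod.le, Nat.mod_self]

@[simp]
theorem rho_apply {n : ℕ} (σ : Equiv.Perm (Fin n)) (v : Vn n) (i : Fin n) :
    (rho σ v : Fin n → ℂ) i = (v : Fin n → ℂ) (σ⁻¹ i) := rfl

theorem mem_Vn {n : ℕ} {v : Fin n → ℂ} : v ∈ Vn n ↔ ∑ i, v i = 0 := by
  simp [Vn]

/-- The standard representation as a monoid homomorphism. -/
noncomputable def rhoHom (n : ℕ) : Equiv.Perm (Fin n) →* Module.End ℂ (Vn n) where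
  toFun := rho
  map_one' := by ext; simp
  map_mul' σ τ := by ext; simp

theorem finrank_Vn {n : ℕ} (hn : 0 < n) : Module.finrank ℂ (Vn n) = n - 1 := by
  set φ : (Fin n → ℂ) →ₗ[ℂ] ℂ := ∑ i : Fin n, LinearMap.proj i with hφ
  have hsurj : Function.Surjective φ := fun c =>
    ⟨Pi.single ⟨0, hn⟩ c, by simp [hφ]⟩
  have h := φ.finrank_range_add_finrank_ker
  rw [LinearMap.range_eq_top.2 hsurj, finrank_top, Module.finrank_self,
    Module.finrank_fin_fun] at h
  change Module.finrank ℂ (LinearMap.ker φ) = n - 1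
  omega

/-- An endomorphism of finite order of a complex vector space has an eigenbasis. -/
theorem exists_eigenbasis_of_pow_eq_one {V : Type*} [AddCommGroup V] [Module ℂ V]
    [FiniteDimensional ℂ V] (f : Module.End ℂ V) {N : ℕ} (hN : 0 < N) (hf : f ^ N = 1) :
    ∃ (b : Module.Basis (Fin (Module.finrank ℂ V)) ℂ V) (μ : Fin (Module.finrank ℂ V) → ℂ),
      ∀ i, f (b i) = μ i • b i := by
  classical
  have hsep : (X ^ N - C (1 : ℂ)).Separable :=
    separable_X_pow_sub_C 1 (by exact_mod_cast hN.ne') one_ne_zero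
  have hss : f.IsSemisimple :=
    Module.End.isSemisimple_of_squarefree_aeval_eq_zero hsep.squarefree (by simp [hf])
  have hint := DirectSum.isInternal_submodule_of_iSupIndep_of_iSup_eq_top
    f.eigenspaces_iSupIndep hss.iSup_eigenspace_eq_top
  let B := hint.collectedBasis fun μ => Module.finBasis ℂ (f.eigenspace μ)
  have : Fintype (Σ μ : ℂ, Fin (Module.finrank ℂ (f.eigenspace μ))) :=
    Module.Basis.fintypeIndexOfRankLtAleph0 B (Module.rank_lt_aleph0 ℂ V)
  let e := Fintype.equivFinOfCardEq (Module.finrank_eq_card_basis B).symm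
  refine ⟨B.reindex e, fun i => (e.symm i).1, fun i => ?_⟩
  rw [Module.Basis.reindex_apply]
  exact Module.End.mem_eigenspace_iff.1 (hint.collectedBasis_mem _ (e.symm i))

theorem charpoly_of_eigenbasis {K V ι : Type*} [Field K] [AddCommGroup V] [Module K V]
    [Module.Finite K V] [Fintype ι] (f : Module.End K V) (b : Module.Basis ι K V) (μ : ι → K)
    (hf : ∀ i, f (b i) = μ i • b i) : f.charpoly = ∏ i, (X - C (μ i)) := by
  classical
  have hmat : LinearMap.toMatrix b b f = Matrix.diagonal μ := by
    ext i j
    rw [LinearMap.toMatrix_apply, hf]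
    by_cases h : i = j
    · subst h; simp
    · simp [h]
  rw [← LinearMap.charpoly_toMatrix f b, hmat, Matrix.charpoly_diagonal]

theorem charpoly_rho_inv {n : ℕ} (σ : Equiv.Perm (Fin n)) :
    (rho σ⁻¹).charpoly = (rho σ).charpoly := by
  obtain ⟨τ, hτ⟩ := isConj_iff.1 (Equiv.Perm.isConj_iff_cycleType_eq.2 σ.cycleType_inv.symm)
  let e : Vn n ≃ₗ[ℂ] Vn n := LinearEquiv.ofLinearMap (rhoHom n τ) (rhoHom n τ⁻¹)
    (by rw [← Module.End.mul_eq_comp, ← map_mul, mul_inv_cancel, map_one]; rfl)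
    (by rw [← Module.End.mul_eq_comp, ← map_mul, inv_mul_cancel, map_one]; rfl)
  rw [← e.charpoly_conj (rho σ), ← hτ]
  congr 1

/-- If `σ` has at least two orbits then `V_n` contains a nonzero `σ`-invariant vector. -/
theorem exists_rho_apply_eq_self {n : ℕ} (σ : Equiv.Perm (Fin n)) (x y : Fin n)
    (hxy : ¬ σ.SameCycle x y) : ∃ w : Vn n, w ≠ 0 ∧ rho σ w = w := by
  classical
  have hn : (n : ℂ) ≠ 0 := by exact_mod_cast (Fin.pos x).ne'
  set u : Fin n → ℂ := fun i => if σ.SameCycle x i then 1 else 0 with hu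
  set m : ℂ := (∑ i, u i) / n with hm
  refine ⟨⟨fun i => u i - m, mem_Vn.2 ?_⟩, fun h => ?_, ?_⟩
  · rw [Finset.sum_sub_distrib]
    simp [hm, mul_div_cancel₀ _ hn]
  · have h' : ∀ i, u i - m = 0 := fun i => congrFun (congrArg Subtype.val h) i
    have hux : u x = 1 := if_pos (Equiv.Perm.SameCycle.refl σ x)
    have huy : u y = 0 := by simp [hu, hxy]
    have h1 := h' x
    have h2 := h' y
    rw [hux] at h1
    rw [huy] at h2
    exact one_ne_zero (sub_left_injective (h1.trans h2.symm))
  · ext i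
    simp [hu, Equiv.Perm.sameCycle_symm_apply_right]

/-- If `σ` is an `n`-cycle then every `n`-th root of unity other than `1` is an eigenvalue of
`σ` on `V_n`. -/
theorem hasEigenvalue_rho_of_isCycleOn_univ {n : ℕ} (hn : 0 < n) {σ : Equiv.Perm (Fin n)}
    (hσ : σ.IsCycleOn Set.univ) {ζ : ℂ} (hζ : ζ ^ n = 1) (hζ1 : ζ ≠ 1) :
    Module.End.HasEigenvalue (rho σ) ζ := by
  have hσ' : σ.IsCycleOn ((Finset.univ : Finset (Fin n)) : Set (Fin n)) := by simpa using hσ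
  let x : Fin n := ⟨0, hn⟩
  have hζ0 : ζ ≠ 0 := by rintro rfl; simp [hn.ne'] at hζ
  choose m _ hm using fun i => hσ'.exists_pow_eq (Finset.mem_univ x) (Finset.mem_univ i)
  have hstep : ∀ i, ζ⁻¹ ^ m i = ζ⁻¹ * ζ⁻¹ ^ m (σ⁻¹ i) := fun i => by
    have h : (σ ^ m i) x = (σ ^ (m (σ⁻¹ i) + 1)) x := by
      rw [pow_succ', Equiv.Perm.mul_apply, hm, hm, ← Equiv.Perm.mul_apply, mul_inv_cancel, Equiv.Perm.one_apply]
    have h' := (hσ'.pow_apply_eq_pow_apply (Finset.mem_univ x)).1 h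
    rw [Finset.card_univ, Fintype.card_fin] at h'
    rw [← pow_succ', pow_eq_pow_mod _ (show ζ⁻¹ ^ n = 1 by rw [inv_pow, hζ, inv_one]), h',
      ← pow_eq_pow_mod _ (show ζ⁻¹ ^ n = 1 by rw [inv_pow, hζ, inv_one])]
  have hsum : ∑ i, ζ⁻¹ ^ m i = 0 := by
    have h : ∑ i, ζ⁻¹ ^ m i = ζ⁻¹ * ∑ i, ζ⁻¹ ^ m i := by
      conv_lhs => rw [Finset.sum_congr rfl fun i _ => hstep i, ← Finset.mul_sum,
        Equiv.sum_comp σ⁻¹ fun i => ζ⁻¹ ^ m i]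
    by_contra h0
    exact hζ1 (inv_eq_one.1 (mul_right_cancel₀ h0 (h.symm.trans (one_mul _).symm)))
  refine Module.End.hasEigenvalue_of_hasEigenvector
    (x := ⟨fun i => ζ⁻¹ ^ m i, mem_Vn.2 hsum⟩) ⟨?_, fun h => ?_⟩
  · rw [Module.End.mem_eigenspace_iff]
    ext i
    simp only [rho_apply, Submodule.coe_smul, Pi.smul_apply, smul_eq_mul]
    rw [hstep i, mul_inv_cancel_left₀ hζ0]
  · exact pow_ne_zero (m x) (inv_ne_zero hζ0) (congrFun (congrArg Subtype.val h) x)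

theorem hasEigenvalue_extPowMap_rho_of_isCycleOn_univ {n k : ℕ} (hk2 : 2 ≤ k) (hk : k + 3 ≤ n)
    {σ : Equiv.Perm (Fin n)} (hσ : σ.IsCycleOn Set.univ) :
    Module.End.HasEigenvalue (extPowMap k (rho σ)) (1 : ℂ) := by
  have hn : n ≠ 0 := by omega
  have hω := Complex.isPrimitiveRoot_exp n hn
  set ω := Complex.exp (2 * Real.pi * Complex.I / n)
  obtain ⟨S, hS, rfl, hdvd⟩ := exists_subset_Icc_card_dvd_sum hk2 hk
  have hbd : ∀ j : S, 0 < (j : ℕ) ∧ (j : ℕ) < n := fun j => by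
    have := Finset.mem_Icc.1 (hS j.2); omega
  have hev : ∀ j : S, Module.End.HasEigenvalue (rho σ) (ω ^ (j : ℕ)) := fun j =>
    hasEigenvalue_rho_of_isCycleOn_univ (by omega) hσ
      (by rw [← pow_mul, mul_comm, pow_mul, hω.pow_eq_one, one_pow])
      (hω.pow_ne_one_of_pos_of_lt (hbd j).1.ne' (hbd j).2)
  choose v hv using fun j => (hev j).exists_hasEigenvector
  have hli := Module.End.eigenvectors_linearIndependent' (rho σ) (fun j : S => ω ^ (j : ℕ))
    (fun i j h => Subtype.ext (hω.pow_inj (hbd i).2 (hbd j).2 h)) v hv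
  have h := hasEigenvalue_extPowMap (rho σ) hli (fun j => (hv j).apply_eq_smul) Finset.univ
  rw [Finset.prod_coe_sort S fun j => ω ^ j, Finset.prod_pow_eq_pow_sum,
    (hω.pow_eq_one_iff_dvd _).2 hdvd, Finset.card_univ, Fintype.card_coe] at h
  exact h

theorem hasEigenvalue_extPowMap_rho_of_not_sameCycle {n k : ℕ} (hk : k + 1 < n)
    {σ : Equiv.Perm (Fin n)} {x y : Fin n} (hxy : ¬ σ.SameCycle x y) :
    Module.End.HasEigenvalue (extPowMap k (rho σ)) (1 : ℂ) := by
  obtain ⟨b, μ, hb⟩ := exists_eigenbasis_of_pow_eq_one (rho σ) (orderOf_pos σ) (by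
    change rhoHom n σ ^ _ = 1
    rw [← map_pow, pow_orderOf_eq_one, map_one])
  have hleft : rho σ⁻¹ ∘ₗ rho σ = LinearMap.id := by
    change rhoHom n σ⁻¹ * rhoHom n σ = 1
    rw [← map_mul, inv_mul_cancel, map_one]
  have hcancel : ∀ v, rho σ⁻¹ (rho σ v) = v := fun v => LinearMap.congr_fun hleft v
  have hμ0 : ∀ i, μ i ≠ 0 := fun i h => b.ne_zero i (by
    rw [← hcancel (b i), hb, h, zero_smul, map_zero])
  have hbinv : ∀ i, rho σ⁻¹ (b i) = (μ i)⁻¹ • b i := fun i => by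
    rw [eq_inv_smul_iff₀ (hμ0 i), ← map_smul, ← hb, hcancel]
  set S : Multiset ℂ := Finset.univ.val.map μ with hS
  have hinv : S.map (·⁻¹) = S := by
    have h := charpoly_rho_inv σ
    rw [charpoly_of_eigenbasis _ b _ hbinv, charpoly_of_eigenbasis _ b _ hb] at h
    have hroots : ∀ ν : Fin (Module.finrank ℂ (Vn n)) → ℂ,
        (∏ i, (X - C (ν i))).roots = Finset.univ.val.map ν := fun ν => by
      rw [← roots_multiset_prod_X_sub_C (Finset.univ.val.map ν), Multiset.map_map]
      rfl
    rw [hS, Multiset.map_map, ← hroots μ, ← h, hroots]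
    rfl
  have h1 : (1 : ℂ) ∈ S := by
    obtain ⟨w, hw0, hw⟩ := exists_rho_apply_eq_self σ x y hxy
    obtain ⟨i, hi⟩ : ∃ i, b.repr w i ≠ 0 := by
      by_contra! h
      exact hw0 (b.repr.map_eq_zero_iff.1 (Finsupp.ext h))
    have hcoord : b.coord i ∘ₗ rho σ = μ i • b.coord i := b.ext fun j => by
      rcases eq_or_ne j i with rfl | hji <;> simp [*]
    have hμi : b.repr w i = μ i * b.repr w i := by
      simpa [hw] using LinearMap.congr_fun hcoord w
    rw [← (mul_eq_right₀ hi).1 hμi.symm]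
    exact Multiset.mem_map_of_mem _ (Finset.mem_univ i)
  obtain ⟨T, hT, hTc, hTp⟩ := exists_le_card_eq_prod_eq_one S (by simpa [hS] using hμ0) h1 hinv
    (k := k) (by simp [hS, finrank_Vn (n := n) (by omega)]; omega)
  obtain ⟨u, hu, rfl⟩ := exists_le_map_eq_of_le_map μ _ T hT
  let U : Finset (Fin (Module.finrank ℂ (Vn n))) := ⟨u, Multiset.nodup_of_le hu Finset.univ.nodup⟩
  have hUc : U.card = k := by rw [← hTc, Multiset.card_map]; rfl
  have hUp : ∏ i ∈ U, μ i = 1 := hTp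
  have h := hasEigenvalue_extPowMap (rho σ) b.linearIndependent hb U
  rwa [hUp, hUc] at h

/-- For `n ≥ 7` and `⌊(n+1)/2⌋ ≤ k ≤ n - 3`, every `σ ∈ S_n` has `1` as an eigenvalue on
`⋀^k V_n`; i.e. the Specht module `S^{(n-k,1^k)}` is unisingular. -/
theorem specht_hook_unisingular_high (n k : ℕ) (hn : 7 ≤ n) (hk2 : (n + 1) / 2 ≤ k)
    (hk : k ≤ n - 3) (σ : Equiv.Perm (Fin n)) :
    Module.End.HasEigenvalue (extPowMap k (rho σ)) (1 : ℂ) := by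
  by_cases h : ∀ x y, σ.SameCycle x y
  · exact hasEigenvalue_extPowMap_rho_of_isCycleOn_univ (by omega) (by omega)
      ⟨Set.bijOn_univ.2 σ.bijective, fun x _ y _ => h x y⟩
  · push Not at h
    obtain ⟨x, y, hxy⟩ := h
    exact hasEigenvalue_extPowMap_rho_of_not_sameCycle (by omega) hxy
end

section
/- For n ≥ 2 and any σ ∈ S_n, the multiplicity of 1 as a root of the characteristic polynomial of the endomorphism ρ(σ) of the standard representation V_n equals r(σ) − 1, where r(σ) = (cycleType σ).card + (n − (cycleType σ).sum) is the number of cycles of σ counting fixed points. -/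
open Polynomial

namespace Equiv.Perm

variable {α : Type*}

theorem SameCycle.apply_eq_of_comp_eq [Finite α] {β : Type*} {σ : Perm α} {v : α → β}
    (hv : v ∘ σ = v) {x y : α} (h : σ.SameCycle x y) : v x = v y := by
  obtain ⟨k, rfl⟩ := h.exists_nat_pow_eq
  clear h
  induction k with
  | zero => rfl
  | succ k ih => rw [pow_succ', mul_apply, ih]; exact (congrFun hv _).symm

/-- The number of orbits of a permutation, expressed through its cycle type. -/
theorem card_quotient_sameCycle [Fintype α] [DecidableEq α] (σ : Perm α) :
    Nat.card (Quotient (SameCycle.setoid σ)) =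
      σ.cycleType.card + (Fintype.card α - σ.cycleType.sum) := by
  let f : α → Perm α ⊕ α := fun x => if σ x = x then .inr x else .inl (σ.cycleOf x)
  have hf : SameCycle.setoid σ = Setoid.ker f := by
    ext x y
    change σ.SameCycle x y ↔ f x = f y
    by_cases hx : σ x = x <;> by_cases hy : σ y = y
    · simp only [f, hx, hy, if_true, Sum.inr.injEq]
      exact ⟨fun h => h.eq_of_left hx, fun h => h.sameCycle σ⟩
    · simp only [f, hx, hy, if_true, if_false, reduceCtorEq, iff_false]
      exact fun h => hy (h.apply_eq_self_iff.1 hx)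
    · simp only [f, hx, hy, if_true, if_false, reduceCtorEq, iff_false]
      exact fun h => hx (h.apply_eq_self_iff.2 hy)
    · simp only [f, hx, hy, if_false, Sum.inl.injEq]
      exact sameCycle_iff_cycleOf_eq_of_mem_support (mem_support.2 hx) (mem_support.2 hy)
  have hr : Set.range f = (σ.cycleFactorsFinset.disjSum σ.supportᶜ : Finset (Perm α ⊕ α)) := by
    ext (c | x)
    · simp only [Set.mem_range, Finset.mem_coe, Finset.inl_mem_disjSum]
      constructor
      · rintro ⟨x, hx⟩
        by_cases h : σ x = x
        · simp [f, h] at hx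
        · simp only [f, h, if_false, Sum.inl.injEq] at hx
          exact hx ▸ cycleOf_mem_cycleFactorsFinset_iff.2 (mem_support.2 h)
      · intro hc
        obtain ⟨x, hx⟩ := (mem_cycleFactorsFinset_iff.1 hc).1.nonempty_support
        have h := mem_support.1 (mem_cycleFactorsFinset_support_le hc hx)
        exact ⟨x, by simp only [f, h, if_false, cycle_is_cycleOf hx hc]⟩
    · simp only [Set.mem_range, Finset.mem_coe, Finset.inr_mem_disjSum, Finset.mem_compl,
        notMem_support]
      constructor
      · rintro ⟨y, hy⟩
        by_cases h : σ y = y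
        · simp only [f, h, if_true, Sum.inr.injEq] at hy
          exact hy ▸ h
        · simp [f, h] at hy
      · exact fun h => ⟨x, by simp [f, h]⟩
  rw [hf, Nat.card_congr (Setoid.quotientKerEquivRange f), hr, Nat.card_coe_set_eq,
    Set.ncard_coe_finset, Finset.card_disjSum, Finset.card_compl, sum_cycleType, cycleType_def,
    Multiset.card_map, Finset.card_val]

end Equiv.Perm

open Equiv.Perm

theorem rho_pow_apply {n : ℕ} (σ : Equiv.Perm (Fin n)) (k : ℕ) (v : Vn n) (i : Fin n) :
    ((rho σ ^ k) v : Fin n → ℂ) i = (v : Fin n → ℂ) ((σ⁻¹ ^ k) i) := by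
  induction k generalizing i with
  | zero => rfl
  | succ k ih =>
    rw [pow_succ', pow_succ]
    exact ih (σ⁻¹ i)

theorem isSemisimple_rho {n : ℕ} (σ : Equiv.Perm (Fin n)) :
    Module.End.IsSemisimple (rho σ) := by
  have hm : ((orderOf σ : ℕ) : ℂ) ≠ 0 := Nat.cast_ne_zero.2 (orderOf_pos σ).ne'
  refine Module.End.isSemisimple_of_squarefree_aeval_eq_zero
    (X_pow_sub_one_separable_iff.2 hm).squarefree ?_
  ext v i
  simp [rho_pow_apply, pow_orderOf_eq_one]

theorem mem_eigenspace_rho_one {n : ℕ} (σ : Equiv.Perm (Fin n)) (v : Vn n) :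
    v ∈ Module.End.eigenspace (rho σ) 1 ↔ (v : Fin n → ℂ) ∘ σ = v := by
  rw [Module.End.mem_eigenspace_iff, one_smul, Subtype.ext_iff]
  change (v : Fin n → ℂ) ∘ ⇑σ.symm = v ↔ _
  rw [Equiv.comp_symm_eq, eq_comm]

/-- The sum over `Fin n` of the pullback of a function on the orbits of `σ`. -/
def orbitSum {n : ℕ} (σ : Equiv.Perm (Fin n)) :
    Module.Dual ℂ (Quotient (SameCycle.setoid σ) → ℂ) :=
  ∑ i : Fin n, LinearMap.proj (Quotient.mk (SameCycle.setoid σ) i)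

theorem map_subtype_eigenspace_rho_one {n : ℕ} (σ : Equiv.Perm (Fin n)) :
    (Module.End.eigenspace (rho σ) 1).map (Vn n).subtype =
      (LinearMap.ker (orbitSum σ)).map
        (LinearMap.funLeft ℂ ℂ (Quotient.mk (SameCycle.setoid σ))) := by
  ext v
  constructor
  · rintro ⟨w, hw, rfl⟩
    have hw' := (mem_eigenspace_rho_one σ w).1 hw
    refine ⟨Quotient.lift (w : Fin n → ℂ) fun x y h => h.apply_eq_of_comp_eq hw', ?_, rfl⟩
    simpa [orbitSum, Vn] using w.2
  · rintro ⟨g, hg, rfl⟩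
    refine ⟨⟨_, ?_⟩, (mem_eigenspace_rho_one σ _).2 ?_, rfl⟩
    · simpa [orbitSum, Vn, LinearMap.funLeft_apply] using hg
    · funext i
      exact congrArg g (Quotient.sound (sameCycle_apply_left.2 SameCycle.rfl))

theorem finrank_eigenspace_rho_one_add_one {n : ℕ} [NeZero n] (σ : Equiv.Perm (Fin n)) :
    Module.finrank ℂ (Module.End.eigenspace (rho σ) 1) + 1 =
      Nat.card (Quotient (SameCycle.setoid σ)) := by
  have : Fintype (Quotient (SameCycle.setoid σ)) := Fintype.ofFinite _
  have h0 : orbitSum σ ≠ 0 := fun h => by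
    have := LinearMap.congr_fun h fun _ => 1
    simp [orbitSum, NeZero.ne] at this
  rw [(Submodule.equivMapOfInjective _ (Vn n).injective_subtype _).finrank_eq,
    map_subtype_eigenspace_rho_one,
    ← (Submodule.equivMapOfInjective _ (LinearMap.funLeft_injective_of_surjective ℂ ℂ _
      Quotient.mk_surjective) (LinearMap.ker (orbitSum σ))).finrank_eq,
    Module.Dual.finrank_ker_add_one_of_ne_zero h0, Module.finrank_fintype_fun_eq_card,
    Nat.card_eq_fintype_card]

/-- For `n ≥ 2` and `σ ∈ S_n`, the multiplicity of `1` as a root of the characteristic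
polynomial of `ρ(σ)` on `V_n` is `r(σ) - 1`, where
`r(σ) = (cycleType σ).card + (n - (cycleType σ).sum)` is the number of cycles of `σ`
counting fixed points. -/
theorem rootMultiplicity_one_charpoly_standard (n : ℕ) (hn : 2 ≤ n)
    (σ : Equiv.Perm (Fin n)) :
    (LinearMap.charpoly (rho σ)).rootMultiplicity 1 =
      (σ.cycleType.card + (n - σ.cycleType.sum)) - 1 := by
  have : NeZero n := ⟨by omega⟩
  rw [← LinearMap.finrank_maxGenEigenspace_eq,
    (isSemisimple_rho σ).isFinitelySemisimple.maxGenEigenspace_eq_eigenspace]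
  have h := finrank_eigenspace_rho_one_add_one σ
  rw [card_quotient_sameCycle, Fintype.card_fin] at h
  omega
end

section
/- Let n ≥ 2 and let σ ∈ S_n be a permutation that is not an n-cycle (i.e. cycleType σ ≠ {n}). Then the endomorphism ρ(σ) of the standard representation V_n has 1 as an eigenvalue. -/
open Polynomial

/-- A permutation of a nontrivial finite set which is not a single full cycle has two points in
different cycles. -/
theorem exists_not_sameCycle_of_cycleType_ne {α : Type*} [Fintype α] [DecidableEq α]
    [Nontrivial α] (σ : Equiv.Perm α) (hσ : σ.cycleType ≠ {Fintype.card α}) :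
    ∃ x y, ¬ σ.SameCycle x y := by
  by_contra! h
  have hne (x : α) : σ x ≠ x := fun hx => by
    obtain ⟨y, hy⟩ := exists_ne x
    exact hy ((h x y).eq_of_left hx).symm
  obtain ⟨x⟩ := (inferInstance : Nonempty α)
  have hc : σ.IsCycle := ⟨x, hne x, fun y _ => h x y⟩
  have hs : σ.support = Finset.univ := by
    ext y
    simp [hne y]
  exact hσ (by rw [hc.cycleType, hs, Finset.card_univ])

/-- A nonconstant vector invariant under `σ` yields, after subtracting its mean, a nonzero fixed
vector of `ρ(σ)`. -/
theorem rho_hasEigenvalue_one_of_invariant {n : ℕ} (σ : Equiv.Perm (Fin n)) (v : Fin n → ℂ)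
    (hv : ∀ i, v (σ⁻¹ i) = v i) {x y : Fin n} (hxy : v x ≠ v y) :
    Module.End.HasEigenvalue (rho σ) (1 : ℂ) := by
  have hn : (n : ℂ) ≠ 0 := Nat.cast_ne_zero.mpr (by have := x.isLt; omega)
  let w : Fin n → ℂ := fun i => v i - (∑ j, v j) / n
  have hw : w ∈ Vn n := by
    simp only [Vn, LinearMap.mem_ker, LinearMap.sum_apply, LinearMap.proj_apply, w,
      Finset.sum_sub_distrib, Finset.sum_const, Finset.card_univ, Fintype.card_fin, nsmul_eq_mul]
    rw [mul_div_cancel₀ _ hn, sub_self]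
  refine Module.End.hasEigenvalue_of_hasEigenvector (x := ⟨w, hw⟩)
    ⟨Module.End.mem_eigenspace_iff.mpr ?_, fun h => ?_⟩
  · rw [one_smul]
    ext i
    exact congrArg (· - (∑ j, v j) / (n : ℂ)) (hv i)
  · have hz (i : Fin n) : v i - (∑ j, v j) / n = 0 := congrFun (congrArg Subtype.val h) i
    exact hxy ((sub_eq_zero.mp (hz x)).trans (sub_eq_zero.mp (hz y)).symm)

/-- For `n ≥ 2` and `σ ∈ S_n` not an `n`-cycle, `ρ(σ)` has `1` as an eigenvalue on the
standard representation `V_n`. -/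
theorem standard_hasEigenvalue_one_of_not_ncycle (n : ℕ) (hn : 2 ≤ n)
    (σ : Equiv.Perm (Fin n)) (hσ : σ.cycleType ≠ {n}) :
    Module.End.HasEigenvalue (rho σ) (1 : ℂ) := by
  have : Nontrivial (Fin n) := Fin.nontrivial_iff_two_le.mpr hn
  obtain ⟨x, y, hxy⟩ := exists_not_sameCycle_of_cycleType_ne σ (by rwa [Fintype.card_fin])
  classical
  refine rho_hasEigenvalue_one_of_invariant σ (fun i => if σ.SameCycle x i then 1 else 0)
    (fun i => ?_) (x := x) (y := y) ?_
  · simp [Equiv.Perm.inv_def, Equiv.Perm.sameCycle_symm_apply_right]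
  · simp [hxy, Equiv.Perm.SameCycle.refl]
end

section
/- Let n ≥ 4. For every σ ∈ S_n, m_σ(X) divides P_σ(X) in ℂ[X]; that is, the characteristic polynomial of the permutation matrix of σ divides the characteristic polynomial of the permutation matrix of the permutation induced by σ on the 2-element subsets of {1,…,n}. (This reflects the decomposition M^{(n−2,2)} = S^{(n−2,2)} ⊕ M^{(n−1,1)}.) -/
open Polynomial

noncomputable section

/-- `m_σ(X)`: the characteristic polynomial of the `n × n` permutation matrix of `σ` over `ℂ`
(the action on the permutation module `M^{(n-1,1)} = ℂ^n`). -/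
def mPoly {n : ℕ} (σ : Equiv.Perm (Fin n)) : ℂ[X] :=
  (σ.permMatrix ℂ).charpoly

/-- The permutation induced by `σ` on the set of 2-element subsets of `{1, …, n}`. -/
def pairsPerm {n : ℕ} (σ : Equiv.Perm (Fin n)) :
    Equiv.Perm {s : Finset (Fin n) // s.card = 2} :=
  Equiv.Perm.subtypePerm (Equiv.finsetCongr σ) fun s => by
    simp [Equiv.finsetCongr_apply, Finset.card_map]

/-- `P_σ(X)`: the characteristic polynomial of the permutation matrix over `ℂ` of the
permutation induced by `σ` on 2-element subsets (the action on `M^{(n-2,2)}`). -/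
def PPoly {n : ℕ} (σ : Equiv.Perm (Fin n)) : ℂ[X] :=
  ((pairsPerm σ).permMatrix ℂ).charpoly

end

/-- If `M` intertwines square matrices `A` and `B` and has a right inverse, then the characteristic
polynomial of `A` divides that of `B` up to a power of `X`. -/
theorem charpoly_dvd_X_pow_mul_charpoly {R m p : Type*} [CommRing R] [Fintype m] [DecidableEq m]
    [Fintype p] [DecidableEq p] {A : Matrix m m R} {B : Matrix p p R} {M : Matrix m p R}
    {N : Matrix p m R} (h : A * M = M * B) (hN : M * N = 1) :
    A.charpoly ∣ X ^ Fintype.card m * B.charpoly := by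
  have hzero : (B * (N * M)) * (B * (1 - N * M)) = 0 := by
    calc (B * (N * M)) * (B * (1 - N * M)) = B * N * ((M * B) * (1 - N * M)) := by
          simp only [Matrix.mul_assoc]
      _ = B * N * (A * (M - M * N * M)) := by
          rw [← h]; simp only [Matrix.mul_assoc, Matrix.mul_sub, Matrix.mul_one]
      _ = 0 := by rw [hN]; simp
  have hprod : (B * (N * M)).charpoly * (B * (1 - N * M)).charpoly =
      X ^ Fintype.card p * B.charpoly := by
    have hz := congrArg (C : R →+* R[X]).mapMatrix hzero
    have hs := congrArg (C : R →+* R[X]).mapMatrix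
      (show B * (N * M) + B * (1 - N * M) = B by rw [← mul_add]; simp)
    rw [map_mul, map_zero] at hz
    rw [map_add] at hs
    simp only [Matrix.charpoly, Matrix.charmatrix]
    have hdet : (Matrix.scalar p (X : R[X])).det = X ^ Fintype.card p := by
      simp [Matrix.scalar_apply]
    rw [← Matrix.det_mul, ← hdet, ← Matrix.det_mul]
    congr 1
    have hc := (Matrix.scalar_commute (n := p) (X : R[X]) (fun r => Commute.all _ r)
      ((C : R →+* R[X]).mapMatrix (B * (N * M)))).eq
    rw [← hs]
    generalize (C : R →+* R[X]).mapMatrix (B * (N * M)) = U at *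
    generalize (C : R →+* R[X]).mapMatrix (B * (1 - N * M)) = V at *
    rw [sub_mul, mul_sub, mul_sub, mul_sub, mul_add, hz, ← hc]
    abel
  have hcomm : X ^ Fintype.card m * (B * (N * M)).charpoly =
      X ^ Fintype.card p * A.charpoly := by
    have := Matrix.charpoly_mul_comm' (B * N) M
    rw [← Matrix.mul_assoc M, ← h, Matrix.mul_assoc A, hN, Matrix.mul_one, Matrix.mul_assoc] at this
    exact this
  refine ⟨(B * (1 - N * M)).charpoly, (Polynomial.monic_X_pow (Fintype.card p)).isRegular.left ?_⟩
  dsimp only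
  rw [← mul_assoc _ A.charpoly, ← hcomm, mul_assoc, hprod]
  ring

/-- Over a field, if `A` is invertible and `M` intertwines `A` and `B` and has a right inverse, then
the characteristic polynomial of `A` divides that of `B`. -/
theorem charpoly_dvd_charpoly_of_intertwines {K m p : Type*} [Field K] [Fintype m] [DecidableEq m]
    [Fintype p] [DecidableEq p] {A : Matrix m m K} {B : Matrix p p K} {M : Matrix m p K}
    {N : Matrix p m K} (hA : A.det ≠ 0) (h : A * M = M * B) (hN : M * N = 1) :
    A.charpoly ∣ B.charpoly := by
  refine IsCoprime.dvd_of_dvd_mul_left (IsCoprime.pow_right ?_)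
    (charpoly_dvd_X_pow_mul_charpoly h hN)
  refine (((Polynomial.irreducible_X (R := K)).coprime_iff_not_dvd).2 fun hX => hA ?_).symm
  rw [Matrix.det_eq_sign_charpoly_coeff, Polynomial.X_dvd_iff.1 hX, mul_zero]

/-- The incidence matrix between points and 2-element subsets of `Fin n`. -/
def pairIncMatrix (n : ℕ) : Matrix (Fin n) {s : Finset (Fin n) // s.card = 2} ℂ :=
  Matrix.of fun i s => if i ∈ s.1 then 1 else 0

theorem permMatrix_mul_pairIncMatrix {n : ℕ} (σ : Equiv.Perm (Fin n)) :
    σ.permMatrix ℂ * pairIncMatrix n = pairIncMatrix n * (pairsPerm σ).permMatrix ℂ := by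
  rw [Equiv.Perm.permMatrix, Equiv.Perm.permMatrix, PEquiv.toMatrix_toPEquiv_mul,
    PEquiv.mul_toMatrix_toPEquiv]
  ext i s
  obtain ⟨t, rfl⟩ := (pairsPerm σ).surjective s
  rw [Matrix.submatrix_apply, Matrix.submatrix_apply, Equiv.symm_apply_apply]
  simp [pairIncMatrix, pairsPerm, Equiv.Perm.subtypePerm_apply]

theorem exists_pairIncMatrix_mul_eq_one {n : ℕ} (hn : 3 ≤ n) :
    ∃ N : Matrix {s : Finset (Fin n) // s.card = 2} (Fin n) ℂ, pairIncMatrix n * N = 1 := by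
  have hex : ∀ i : Fin n, ∃ j k : Fin n, i ≠ j ∧ i ≠ k ∧ j ≠ k := fun i => by
    obtain ⟨j, hj⟩ := Finset.exists_mem_notMem_of_card_lt_card
      (s := {i}) (t := (Finset.univ : Finset (Fin n))) (by simp; omega)
    obtain ⟨k, hk⟩ := Finset.exists_mem_notMem_of_card_lt_card
      (s := {i, j}) (t := (Finset.univ : Finset (Fin n)))
      (by have := Finset.card_le_two (a := i) (b := j); simp; omega)
    refine ⟨j, k, ?_⟩
    simp at hj hk
    grind
  choose j k hij hik hjk using hex
  refine ⟨Matrix.of fun s i =>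
    ((if s = ⟨{i, j i}, Finset.card_pair (hij i)⟩ then 1 else 0) +
      (if s = ⟨{i, k i}, Finset.card_pair (hik i)⟩ then 1 else 0) -
      (if s = ⟨{j i, k i}, Finset.card_pair (hjk i)⟩ then 1 else 0)) / 2, ?_⟩
  ext a i
  simp only [Matrix.mul_apply, pairIncMatrix, Matrix.of_apply, mul_div_assoc', mul_add, mul_sub,
    ← Finset.sum_div, Finset.sum_add_distrib, Finset.sum_sub_distrib, mul_ite, mul_one, mul_zero,
    Finset.sum_ite_eq', Finset.mem_univ, if_true, Finset.mem_insert, Finset.mem_singleton,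
    Matrix.one_apply]
  have h1 := hij i
  have h2 := hik i
  have h3 := hjk i
  by_cases ha : a = i
  · subst ha; simp [h1, h2]
  by_cases hb : a = j i
  · simp [hb, h1.symm, h3]
  by_cases hc : a = k i
  · simp [hc, h2.symm, h3.symm]
  simp [ha, hb, hc]

/-- For `n ≥ 4` and every `σ ∈ S_n`, `m_σ(X)` divides `P_σ(X)` in `ℂ[X]`
(reflecting `M^{(n-2,2)} = S^{(n-2,2)} ⊕ M^{(n-1,1)}`). -/
theorem mPoly_dvd_PPoly (n : ℕ) (hn : 4 ≤ n) (σ : Equiv.Perm (Fin n)) :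
    mPoly σ ∣ PPoly σ := by
  obtain ⟨N, hN⟩ := exists_pairIncMatrix_mul_eq_one (n := n) (by omega)
  refine charpoly_dvd_charpoly_of_intertwines ?_ (permMatrix_mul_pairIncMatrix σ) hN
  rw [Matrix.det_permutation]
  exact_mod_cast (Equiv.Perm.sign σ).ne_zero
end

section
/- Let n ≥ 5 be odd, and let σ ∈ S_n have cycle type (n−2,2), i.e. cycleType σ = {n−2, 2}. Then P_σ(X) = (X^{n−2} − 1)^{(n−3)/2} · (X^{2n−4} − 1) · (X − 1). -/
open Polynomial

namespace Equiv.Perm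

open Matrix

section Charpoly

variable {R α β : Type*} [CommRing R] [Fintype α] [DecidableEq α] [Fintype β] [DecidableEq β]

theorem charpoly_permMatrix_eq_of_semiconj (ρ : Perm α) (τ : Perm β) (e : α ≃ β)
    (h : ∀ a, e (ρ a) = τ (e a)) : (ρ.permMatrix R).charpoly = (τ.permMatrix R).charpoly := by
  rw [← charpoly_reindex e]
  congr 1
  ext i j
  have hi := h (e.symm i)
  rw [e.apply_symm_apply] at hi
  simp [PEquiv.toMatrix_apply, Equiv.toPEquiv_apply, ← hi, ← Equiv.eq_symm_apply]

theorem charpoly_permMatrix_sumCongr (ρ : Perm α) (τ : Perm β) :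
    (Perm.permMatrix R (Perm.sumCongr ρ τ)).charpoly =
      (ρ.permMatrix R).charpoly * (τ.permMatrix R).charpoly := by
  rw [← charpoly_fromBlocks_zero₂₁ (M₁₁ := ρ.permMatrix R) (M₁₂ := 0)]
  congr 1
  ext (i | i) (j | j) <;> simp [PEquiv.toMatrix_apply, Equiv.toPEquiv_apply]

theorem charpoly_permMatrix_prodCongr_refl (ρ : Perm α) :
    (Perm.permMatrix R (Equiv.prodCongr ρ (Equiv.refl β))).charpoly =
      (ρ.permMatrix R).charpoly ^ Fintype.card β := by
  have h : (Perm.permMatrix R (Equiv.prodCongr ρ (Equiv.refl β))).charmatrix =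
      blockDiagonal fun _ : β => (ρ.permMatrix R).charmatrix := by
    ext1 ⟨i, k⟩ ⟨j, l⟩
    by_cases hk : k = l
    · subst hk
      by_cases hi : i = j <;>
        simp [blockDiagonal_apply, PEquiv.toMatrix_apply, Equiv.toPEquiv_apply, hi]
    · simp [blockDiagonal_apply, PEquiv.toMatrix_apply, Equiv.toPEquiv_apply, hk]
  rw [charpoly, h, det_blockDiagonal, Finset.prod_const, Finset.card_univ, charpoly]

theorem charpoly_permMatrix_refl_unit :
    (Perm.permMatrix R (Equiv.refl Unit)).charpoly = X - 1 := by
  rw [permMatrix_refl, charpoly_one]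
  simp

theorem charpoly_permMatrix_addRight_one (k : ℕ) [NeZero k] :
    (Perm.permMatrix ℂ (Equiv.addRight (1 : ZMod k))).charpoly = X ^ k - 1 := by
  have hk : 0 < k := Nat.pos_of_neZero k
  set M := Perm.permMatrix ℂ (Equiv.addRight (1 : ZMod k)) with hM
  have hmonic : (X ^ k - 1 : ℂ[X]).Monic := monic_X_pow_sub_C (1 : ℂ) hk.ne'
  have hdeg : (X ^ k - 1 : ℂ[X]).natDegree = k := natDegree_X_pow_sub_C (r := (1 : ℂ))
  refine eq_of_monic_of_dvd_of_natDegree_le hmonic M.charpoly_monic ?_ ?_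
  · have hζ := Complex.isPrimitiveRoot_exp k hk.ne'
    rw [X_pow_sub_one_eq_prod hk hζ]
    refine Finset.prod_dvd_of_coprime
      (fun a _ b _ hab => pairwise_coprime_X_sub_C Function.injective_id hab) fun ω hω => ?_
    rw [mem_nthRootsFinset hk] at hω
    rw [dvd_iff_isRoot, ← Matrix.mem_spectrum_iff_isRoot_charpoly, ← spectrum_toLin',
      ← Module.End.hasEigenvalue_iff_mem_spectrum]
    refine Module.End.hasEigenvalue_of_hasEigenvector (x := AddChar.zmodChar k hω) ⟨?_, ?_⟩
    · rw [Module.End.mem_eigenspace_iff, toLin'_apply, hM, permMatrix_mulVec]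
      ext j
      have h1 : AddChar.zmodChar k hω (1 : ZMod k) = ω := by
        simpa using AddChar.zmodChar_apply' hω 1
      simp [AddChar.map_add_eq_mul, h1, mul_comm]
    · intro h0
      have := congrFun h0 0
      simp at this
  · rw [charpoly_natDegree_eq_dim, ZMod.card, hdeg]

end Charpoly

theorem IsCycle.exists_zmod_parametrization {α : Type*} [Fintype α] [DecidableEq α]
    {c : Perm α} (hc : c.IsCycle) {k : ℕ} [NeZero k] (hk : c.support.card = k) :
    ∃ f : ZMod k → α, Function.Injective f ∧ (∀ i, c (f i) = f (i + 1)) ∧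
      ∀ i, f i ∈ c.support := by
  obtain ⟨a, ha⟩ := hc.nonempty_support
  have hon : c.IsCycleOn (c.support : Set α) := by
    simpa [Equiv.Perm.coe_support_eq_set_support] using hc.isCycleOn
  have key : ∀ p q : ℕ, (c ^ p) a = (c ^ q) a ↔ p ≡ q [MOD k] := fun p q => by
    rw [hon.pow_apply_eq_pow_apply ha, hk]
  refine ⟨fun i => (c ^ i.val) a, fun i j h => ?_, fun i => ?_, fun i => ?_⟩
  · have := (key _ _).1 h
    rw [← ZMod.natCast_eq_natCast_iff] at this
    simpa using this
  · change c ((c ^ i.val) a) = _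
    rw [← Perm.mul_apply, ← pow_succ', key, ← ZMod.natCast_eq_natCast_iff]
    simp
  · simpa using ha

end Equiv.Perm

open Equiv.Perm

theorem Equiv.Perm.exists_zmod_parametrization_of_cycleType_pair {α : Type*} [Fintype α]
    [DecidableEq α] {σ : Equiv.Perm α} {k l : ℕ} [NeZero k] [NeZero l]
    (hσ : σ.cycleType = {k, l}) :
    ∃ (f : ZMod k → α) (g : ZMod l → α), Function.Injective f ∧ Function.Injective g ∧
      (∀ i j, f i ≠ g j) ∧ (∀ i, σ (f i) = f (i + 1)) ∧ ∀ j, σ (g j) = g (j + 1) := by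
  obtain ⟨c, τ, rfl, hd, hc, hk⟩ := mem_cycleType_iff.1
    (show k ∈ σ.cycleType by simp [hσ])
  have hτ : τ.cycleType = {l} := by
    rw [hd.cycleType_mul, hc.cycleType, hk] at hσ
    exact add_left_cancel (a := ({k} : Multiset ℕ)) hσ
  have hτc : τ.IsCycle := card_cycleType_eq_one.1 (by simp [hτ])
  have hl : τ.support.card = l := by
    rw [← sum_cycleType, hτ, Multiset.sum_singleton]
  obtain ⟨f, hf, hfc, hfs⟩ := hc.exists_zmod_parametrization hk
  obtain ⟨g, hg, hgc, hgs⟩ := hτc.exists_zmod_parametrization hl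
  have hdisj := Finset.disjoint_left.1 (disjoint_iff_disjoint_support.1 hd)
  refine ⟨f, g, hf, hg, fun i j h => hdisj (hfs i) (h ▸ hgs j), fun i => ?_, fun j => ?_⟩
  · rw [mul_apply, notMem_support.1 (hdisj (hfs i)), hfc]
  · rw [mul_apply, hgc]
    exact notMem_support.1 fun h => hdisj h (hgs _)

theorem coe_pairsPerm_mk_pair {n : ℕ} (σ : Equiv.Perm (Fin n)) {a b : Fin n}
    (h : ({a, b} : Finset (Fin n)).card = 2) :
    (pairsPerm σ ⟨{a, b}, h⟩ : Finset (Fin n)) = {σ a, σ b} := by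
  simp [pairsPerm, Equiv.Perm.subtypePerm_apply, Equiv.finsetCongr_apply, Finset.map_insert]

theorem Finset.pair_eq_pair_iff' {α : Type*} [DecidableEq α] {a b c d : α} :
    ({a, b} : Finset α) = {c, d} ↔ a = c ∧ b = d ∨ a = d ∧ b = c := by
  rw [← Finset.coe_inj]
  simpa using Set.pair_eq_pair_iff

section Chords

variable {m q : ℕ}

theorem natCast_succ_fin_ne_zero (hm : m = 2 * q + 1) (d : Fin q) :
    ((d.val + 1 : ℕ) : ZMod m) ≠ 0 := by
  rw [Ne, ZMod.natCast_eq_zero_iff]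
  intro h
  have := Nat.le_of_dvd (by omega) h
  omega

theorem chord_injective (hm : m = 2 * q + 1) {i j : ZMod m} {d e : Fin q}
    (h : i = j ∧ i + (d.val + 1 : ℕ) = j + (e.val + 1 : ℕ) ∨
      i = j + (e.val + 1 : ℕ) ∧ i + (d.val + 1 : ℕ) = j) : i = j ∧ d = e := by
  rcases h with ⟨rfl, h⟩ | ⟨h1, h2⟩
  · refine ⟨rfl, Fin.ext ?_⟩
    have h := add_left_cancel h
    rw [ZMod.natCast_eq_natCast_iff'] at h
    rw [Nat.mod_eq_of_lt (by omega), Nat.mod_eq_of_lt (by omega)] at h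
    omega
  · have h : ((e.val + 1 + (d.val + 1) : ℕ) : ZMod m) = 0 := by
      rw [h1, add_assoc] at h2
      rw [Nat.cast_add]
      exact add_eq_left.1 h2
    rw [ZMod.natCast_eq_zero_iff] at h
    have := Nat.le_of_dvd (by omega) h
    omega

end Chords

theorem card_pairs_eq (n q : ℕ) (hn : n = 2 * q + 3) :
    Fintype.card {s : Finset (Fin n) // s.card = 2} =
      (2 * q + 1) * q + ((2 * q + 1) * 2 + 1) := by
  rw [Fintype.card_finset_len, Fintype.card_fin, hn, Nat.choose_two_right]
  refine Nat.div_eq_of_eq_mul_left two_pos ?_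
  rw [show 2 * q + 3 - 1 = 2 * q + 2 by omega]
  ring

/-- For odd `n ≥ 5` and `σ ∈ S_n` of cycle type `(n-2,2)`,
`P_σ(X) = (X^{n-2} - 1)^{(n-3)/2} · (X^{2n-4} - 1) · (X - 1)`. -/
theorem PPoly_of_cycleType_nsub2_2 (n : ℕ) (hn : 5 ≤ n) (hodd : Odd n)
    (σ : Equiv.Perm (Fin n)) (hσ : σ.cycleType = {n - 2, 2}) :
    PPoly σ = ((X : ℂ[X]) ^ (n - 2) - 1) ^ ((n - 3) / 2) *
      ((X : ℂ[X]) ^ (2 * n - 4) - 1) * ((X : ℂ[X]) - 1) := by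
  obtain ⟨q, hq⟩ : ∃ q, n = 2 * q + 3 := by
    obtain ⟨r, hr⟩ := hodd
    exact ⟨r - 1, by omega⟩
  obtain ⟨m, hm⟩ : ∃ m, m = 2 * q + 1 := ⟨_, rfl⟩
  have : NeZero m := ⟨by omega⟩
  rw [show n - 2 = m by omega] at hσ ⊢
  rw [show (n - 3) / 2 = q by omega, show 2 * n - 4 = m * 2 by omega]
  obtain ⟨f, g, hf, hg, hfg, hσf, hσg⟩ := exists_zmod_parametrization_of_cycleType_pair hσ
  let ρ : Equiv.Perm ((ZMod m × Fin q) ⊕ ((ZMod m × ZMod 2) ⊕ Unit)) :=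
    Equiv.Perm.sumCongr (Equiv.prodCongr (Equiv.addRight 1) (Equiv.refl _))
      (Equiv.Perm.sumCongr (Equiv.prodCongr (Equiv.addRight 1) (Equiv.addRight 1)) (Equiv.refl _))
  have hchord (i : ZMod m) (d : Fin q) : f i ≠ f (i + (d.val + 1 : ℕ)) := fun h =>
    natCast_succ_fin_ne_zero hm d (left_eq_add.1 (hf h))
  have hg01 : g 0 ≠ g 1 := fun h => zero_ne_one (hg h)
  let F : (ZMod m × Fin q) ⊕ ((ZMod m × ZMod 2) ⊕ Unit) → {s : Finset (Fin n) // s.card = 2} :=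
    Sum.elim (fun x => ⟨{f x.1, f (x.1 + (x.2.val + 1 : ℕ))}, Finset.card_pair (hchord _ _)⟩)
      (Sum.elim (fun x => ⟨{f x.1, g x.2}, Finset.card_pair (hfg _ _)⟩)
        fun _ => ⟨{g 0, g 1}, Finset.card_pair hg01⟩)
  have hFinj : Function.Injective F := by
    rintro (⟨i, d⟩ | ⟨i, a⟩ | _) (⟨j, e⟩ | ⟨j, b⟩ | _) h <;>
      simp only [F, Sum.elim_inl, Sum.elim_inr, Subtype.mk.injEq, Finset.pair_eq_pair_iff',
        hf.eq_iff, hg.eq_iff, hfg, (hfg _ _).symm, and_false, false_and, or_false] at h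
    · obtain ⟨rfl, rfl⟩ := chord_injective hm h
      rfl
    · obtain ⟨rfl, rfl⟩ := h
      rfl
    · rfl
  have hFbij : Function.Bijective F := by
    refine (Fintype.bijective_iff_injective_and_card F).2 ⟨hFinj, ?_⟩
    rw [card_pairs_eq n q hq]
    simp [ZMod.card, hm]
  have hFρ (x) : F (ρ x) = pairsPerm σ (F x) := by
    apply Subtype.ext
    rcases x with ⟨i, d⟩ | ⟨i, a⟩ | _ <;>
      simp only [F, ρ, Sum.elim_inl, Sum.elim_inr, coe_pairsPerm_mk_pair, hσf, hσg,
        Equiv.Perm.sumCongr_apply, Sum.map_inl, Sum.map_inr, Equiv.prodCongr_apply, Prod.map,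
        Equiv.coe_addRight, Equiv.refl_apply, add_right_comm]
    rw [show (0 : ZMod 2) + 1 = 1 from rfl, show (1 : ZMod 2) + 1 = 0 from rfl, Finset.pair_comm]
  have hcop : Nat.Coprime m 2 := by
    rw [Nat.coprime_two_right, hm]
    exact ⟨q, rfl⟩
  have hcrt : (Equiv.Perm.permMatrix ℂ (Equiv.prodCongr (Equiv.addRight (1 : ZMod m))
      (Equiv.addRight (1 : ZMod 2)))).charpoly = X ^ (m * 2) - 1 := by
    rw [← charpoly_permMatrix_addRight_one]
    symm
    refine charpoly_permMatrix_eq_of_semiconj _ _ (ZMod.chineseRemainder hcop).toEquiv fun x => ?_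
    simp [Prod.ext_iff]
  rw [PPoly, ← charpoly_permMatrix_eq_of_semiconj ρ (pairsPerm σ) (Equiv.ofBijective F hFbij) hFρ,
    charpoly_permMatrix_sumCongr, charpoly_permMatrix_sumCongr, hcrt,
    charpoly_permMatrix_prodCongr_refl, charpoly_permMatrix_addRight_one,
    charpoly_permMatrix_refl_unit, Fintype.card_fin, mul_assoc]
end

section
/- Let n ≥ 5 be odd, and let σ ∈ S_n have cycle type (n−2,2), i.e. cycleType σ = {n−2, 2}. Then the multiplicity of −1 as a root of P_σ(X) equals the multiplicity of −1 as a root of m_σ(X) (both equal 1). Consequently the characteristic polynomial of σ on the Specht module S^{(n−2,2)} (the cofactor P_σ/m_σ) does not vanish at −1, and the Specht module S^{(2²,1^{n−4})} = S^{(n−2,2)} ⊗ sgn is not unisingular for odd n. -/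
open Polynomial

open Equiv.Perm

theorem permMatrix_pow_apply {α R : Type*} [Fintype α] [DecidableEq α] [CommRing R]
    (f : Equiv.Perm α) (i : ℕ) (x y : α) :
    (f.permMatrix R ^ i) x y = if (f ^ i) x = y then 1 else 0 := by
  induction i generalizing x with
  | zero => simp [Matrix.one_apply]
  | succ i ih =>
    rw [pow_succ', Matrix.mul_apply, Finset.sum_eq_single (f x)]
    · simp [ih, PEquiv.toMatrix_apply, pow_succ]
    · intro y _ hy
      simp [PEquiv.toMatrix_apply, hy.symm]
    · simp

/-- The characteristic polynomial of the permutation matrix of a transitive permutation. -/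
theorem charpoly_permMatrix_of_isCycleOn_univ {α R : Type*} [Fintype α] [DecidableEq α]
    [CommRing R] (f : Equiv.Perm α) (hf : f.IsCycleOn (Finset.univ : Finset α)) [Nonempty α] :
    (f.permMatrix R).charpoly = X ^ Fintype.card α - 1 := by
  nontriviality R
  obtain ⟨x⟩ := ‹Nonempty α›
  have hN : 0 < Fintype.card α := Fintype.card_pos_iff.2 ⟨x⟩
  set p := (f.permMatrix R).charpoly with hp
  have hdeg : p.natDegree = Fintype.card α := Matrix.charpoly_natDegree_eq_dim _
  have hlead : p.coeff (Fintype.card α) = 1 := by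
    rw [← hdeg]; exact (Matrix.charpoly_monic _)
  have hsum (j : ℕ) : ∑ i ∈ Finset.range (Fintype.card α + 1),
      (if (f ^ i) x = (f ^ j) x then p.coeff i else 0) = 0 := by
    have h := congrFun (congrFun (Matrix.aeval_self_charpoly (f.permMatrix R)) x) ((f ^ j) x)
    rw [← hp, aeval_eq_sum_range, hdeg, Matrix.sum_apply] at h
    simpa [permMatrix_pow_apply] using h
  have hpow (i j : ℕ) : (f ^ i) x = (f ^ j) x ↔ i ≡ j [MOD Fintype.card α] := by
    rw [hf.pow_apply_eq_pow_apply (Finset.mem_univ x), Finset.card_univ]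
  simp only [hpow, Finset.sum_range_succ, hlead] at hsum
  have hsum' {j : ℕ} (hj : j < Fintype.card α) :
      p.coeff j + (if j = 0 then 1 else 0) = 0 := by
    refine Eq.trans ?_ (hsum j)
    congr 1
    · rw [Finset.sum_eq_single_of_mem j (Finset.mem_range.2 hj)]
      · simp [Nat.ModEq.refl]
      · intro i hi hij
        exact if_neg fun h => hij (h.eq_of_lt_of_lt (Finset.mem_range.1 hi) hj)
    · refine if_congr ?_ rfl rfl
      rw [Nat.ModEq, Nat.mod_self, Nat.mod_eq_of_lt hj, eq_comm]
  ext j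
  rw [coeff_sub, coeff_X_pow, coeff_one]
  rcases lt_trichotomy j (Fintype.card α) with hj | rfl | hj
  · rw [if_neg hj.ne, zero_sub]
    exact eq_neg_of_add_eq_zero_left (hsum' hj)
  · simp [hlead, hN.ne']
  · rw [coeff_eq_zero_of_natDegree_lt (hdeg.trans_lt hj)]
    simp [hj.ne', (hN.trans hj).ne']

/-- The number of elements in a cycle of `f`, fixed points being cycles of length one. -/
noncomputable def cycleCard {α : Type*} (f : Equiv.Perm α) (q : Quotient (SameCycle.setoid f)) :
    ℕ :=
  Nat.card {y : α // Quotient.mk (SameCycle.setoid f) y = q}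

theorem mk_sameCycle_eq_iff {α : Type*} {f : Equiv.Perm α} {x y : α} :
    Quotient.mk (SameCycle.setoid f) x = Quotient.mk (SameCycle.setoid f) y ↔ f.SameCycle x y :=
  Quotient.eq

theorem pow_apply_eq_self_iff_cycleCard_dvd {α : Type*} [Finite α] (f : Equiv.Perm α) (x : α)
    (i : ℕ) : (f ^ i) x = x ↔ cycleCard f (Quotient.mk _ x) ∣ i := by
  classical
  have := Fintype.ofFinite α
  have h : f.IsCycleOn ((Finset.univ.filter fun y =>
      Quotient.mk (SameCycle.setoid f) y = Quotient.mk _ x : Finset α) : Set α) := by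
    simp only [mk_sameCycle_eq_iff]
    refine ⟨f.bijOn fun y => by simp, fun y hy z hz => ?_⟩
    simp only [Finset.coe_filter, Finset.mem_univ, true_and, Set.mem_ofPred_eq] at hy hz
    exact hy.trans hz.symm
  rw [h.pow_apply_eq (by simp), cycleCard, Nat.card_eq_fintype_card, Fintype.card_subtype]

theorem cycleCard_mk_eq {α : Type*} [Finite α] {f : Equiv.Perm α} {x : α} {k : ℕ}
    (h : ∀ i, (f ^ i) x = x ↔ k ∣ i) : cycleCard f (Quotient.mk _ x) = k :=
  Nat.dvd_antisymm ((pow_apply_eq_self_iff_cycleCard_dvd f x k).1 ((h k).2 dvd_rfl))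
    ((h _).1 ((pow_apply_eq_self_iff_cycleCard_dvd f x _).2 dvd_rfl))

open scoped Classical in
/-- The characteristic polynomial of a permutation matrix is the product of `X ^ k - 1` over the
lengths `k` of the cycles. -/
theorem charpoly_permMatrix {α R : Type*} [Fintype α] [DecidableEq α] [CommRing R]
    (f : Equiv.Perm α) :
    (f.permMatrix R).charpoly =
      ∏ q : Quotient (SameCycle.setoid f), (X ^ cycleCard f q - 1) := by
  let b : α → Quotient (SameCycle.setoid f) := Quotient.mk _
  let _ : LinearOrder (Quotient (SameCycle.setoid f)) :=
    LinearOrder.lift' (Fintype.equivFin _) (Fintype.equivFin _).injective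
  have hb (y : α) : b (f y) = b y := mk_sameCycle_eq_iff.2 (by simp [SameCycle.refl])
  have htri : (f.permMatrix R).BlockTriangular b := by
    intro i j hij
    have : f i ≠ j := by rintro rfl; exact hij.ne (hb i)
    simp [PEquiv.toMatrix_apply, this]
  rw [htri.charpoly]
  refine Finset.prod_congr
    (Finset.eq_univ_of_forall fun q => by simpa using Quotient.exists_rep q) fun q _ => ?_
  have hne : Nonempty {y // b y = q} := by
    obtain ⟨y, rfl⟩ := Quotient.exists_rep q
    exact ⟨⟨y, rfl⟩⟩
  let g : Equiv.Perm {y // b y = q} := f.subtypePerm fun y => by rw [hb]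
  have hg : (f.permMatrix R).toSquareBlock b q = g.permMatrix R := by
    ext i j
    simp [Matrix.toSquareBlock_def, PEquiv.toMatrix_apply, g, Subtype.ext_iff]
  have hcyc : g.IsCycleOn (Finset.univ : Finset {y // b y = q}) := by
    refine ⟨by simp, fun y _ z _ => ?_⟩
    rw [sameCycle_subtypePerm, ← mk_sameCycle_eq_iff]
    exact y.2.trans z.2.symm
  rw [hg, cycleCard, Nat.card_eq_fintype_card]
  convert charpoly_permMatrix_of_isCycleOn_univ g hcyc

theorem exists_card_support_cycleOf_eq {α : Type*} [Fintype α] [DecidableEq α]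
    {σ : Equiv.Perm α} {k : ℕ} (hk : k ∈ σ.cycleType) :
    ∃ x, σ x ≠ x ∧ (σ.cycleOf x).support.card = k := by
  obtain ⟨c, hc, hck⟩ := Multiset.mem_map.1 (cycleType_def σ ▸ hk)
  obtain ⟨x, hx, -⟩ := (mem_cycleFactorsFinset_iff.1 hc).1
  rw [← mem_support] at hx
  refine ⟨x, mem_support.1 (mem_cycleFactorsFinset_support_le hc hx), ?_⟩
  rw [← cycle_is_cycleOf hx hc]
  exact hck

theorem pow_apply_eq_self_iff_card_support_cycleOf_dvd {α : Type*} [Fintype α] [DecidableEq α]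
    {σ : Equiv.Perm α} {x : α} (hx : σ x ≠ x) (i : ℕ) :
    (σ ^ i) x = x ↔ (σ.cycleOf x).support.card ∣ i :=
  (isCycleOn_support_cycleOf σ x).pow_apply_eq
    ((mem_support_cycleOf_iff' hx).2 (SameCycle.refl _ _))

/-- A permutation without fixed points which has exactly two cycles, of distinct lengths. -/
theorem exists_of_cycleType_eq_pair {α : Type*} [Fintype α] [DecidableEq α]
    {σ : Equiv.Perm α} {k l : ℕ} (hσ : σ.cycleType = {k, l}) (hkl : k ≠ l)
    (hcard : k + l = Fintype.card α) :
    ∃ x a, (∀ i, (σ ^ i) x = x ↔ k ∣ i) ∧ (∀ i, (σ ^ i) a = a ↔ l ∣ i) ∧ ¬ σ.SameCycle a x ∧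
      ∀ y, σ.SameCycle x y ∨ σ.SameCycle a y := by
  obtain ⟨x, hx, hxk⟩ := exists_card_support_cycleOf_eq (σ := σ) (k := k) (by simp [hσ])
  obtain ⟨a, ha, hal⟩ := exists_card_support_cycleOf_eq (σ := σ) (k := l) (by simp [hσ])
  have hax : ¬ σ.SameCycle a x := fun h => hkl (by rw [← hxk, ← hal, h.cycleOf_eq])
  refine ⟨x, a, fun i => ?_, fun i => ?_, hax, fun y => ?_⟩
  · rw [pow_apply_eq_self_iff_card_support_cycleOf_dvd hx, hxk]
  · rw [pow_apply_eq_self_iff_card_support_cycleOf_dvd ha, hal]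
  · have hdisj : _root_.Disjoint (σ.cycleOf x).support (σ.cycleOf a).support := by
      refine Finset.disjoint_left.2 fun y hy hy' => hax ?_
      rw [mem_support_cycleOf_iff' hx] at hy
      rw [mem_support_cycleOf_iff' ha] at hy'
      exact hy'.trans hy.symm
    have huniv : (σ.cycleOf x).support ∪ (σ.cycleOf a).support = Finset.univ := by
      rw [← Finset.card_eq_iff_eq_univ, Finset.card_union_of_disjoint hdisj, hxk, hal, hcard]
    rw [← mem_support_cycleOf_iff' hx, ← mem_support_cycleOf_iff' ha, ← Finset.mem_union, huniv]
    exact Finset.mem_univ y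

theorem pow_apply_eq_pow_apply_of_modEq {α : Type*} {σ : Equiv.Perm α} {x : α} {k i j : ℕ}
    (hx : (σ ^ k) x = x) (h : i ≡ j [MOD k]) : (σ ^ i) x = (σ ^ j) x := by
  have hmod (i : ℕ) : (σ ^ i) x = (σ ^ (i % k)) x := by
    conv_lhs => rw [← Nat.mod_add_div i k, pow_add, pow_mul, mul_apply,
      pow_apply_eq_self_of_apply_eq_self hx]
  rw [hmod i, hmod j, h]

/-- The two-element subset `{u, v}`. -/
def finsetPair {α : Type*} [DecidableEq α] (u v : α) (h : u ≠ v) :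
    {s : Finset α // s.card = 2} :=
  ⟨{u, v}, Finset.card_pair h⟩

theorem finsetPair_eq_iff {α : Type*} [DecidableEq α] {u v u' v' : α} {h : u ≠ v}
    {h' : u' ≠ v'} :
    finsetPair u v h = finsetPair u' v' h' ↔ u = u' ∧ v = v' ∨ u = v' ∧ v = u' := by
  rw [finsetPair, finsetPair, Subtype.mk.injEq, ← Finset.coe_inj]
  push_cast
  exact Set.pair_eq_pair_iff

theorem pairsPerm_pow_finsetPair {n : ℕ} (σ : Equiv.Perm (Fin n)) (i : ℕ) (u v : Fin n)
    (h : u ≠ v) :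
    (pairsPerm σ ^ i) (finsetPair u v h) =
      finsetPair ((σ ^ i) u) ((σ ^ i) v) ((σ ^ i).injective.ne h) := by
  induction i with
  | zero => rfl
  | succ i ih =>
    rw [pow_succ', mul_apply, ih]
    refine Subtype.ext ?_
    simp [pairsPerm, finsetPair, Equiv.finsetCongr_apply, pow_succ']

theorem mPoly_eq {n k : ℕ} {σ : Equiv.Perm (Fin n)} {x a : Fin n}
    (hx : ∀ i, (σ ^ i) x = x ↔ k ∣ i) (ha : ∀ i, (σ ^ i) a = a ↔ 2 ∣ i)
    (hax : ¬ σ.SameCycle a x) (hcover : ∀ y, σ.SameCycle x y ∨ σ.SameCycle a y) :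
    mPoly σ = (X ^ k - 1) * (X ^ 2 - 1) := by
  classical
  have hne : Quotient.mk (SameCycle.setoid σ) x ≠ Quotient.mk _ a := by
    rw [Ne, mk_sameCycle_eq_iff, sameCycle_comm]
    exact hax
  have huniv : (Finset.univ : Finset (Quotient (SameCycle.setoid σ))) =
      {Quotient.mk _ x, Quotient.mk _ a} := by
    refine (Finset.eq_univ_of_forall fun q => ?_).symm
    induction q using Quotient.inductionOn with | h y => ?_
    rw [Finset.mem_insert, Finset.mem_singleton, mk_sameCycle_eq_iff, mk_sameCycle_eq_iff,
      sameCycle_comm, sameCycle_comm (y := a)]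
    exact hcover y
  rw [mPoly, charpoly_permMatrix, huniv, Finset.prod_pair hne, cycleCard_mk_eq hx,
    cycleCard_mk_eq ha]

theorem exists_pow_apply_eq_and_pow_apply_eq {n k : ℕ} {σ : Equiv.Perm (Fin n)} {x a u v : Fin n}
    (hodd : Odd k) (hx : (σ ^ k) x = x) (ha : (σ ^ 2) a = a)
    (hu : σ.SameCycle a u) (hv : σ.SameCycle x v) : ∃ l, (σ ^ l) a = u ∧ (σ ^ l) x = v := by
  obtain ⟨i, -, rfl⟩ := hu.exists_pow_eq'
  obtain ⟨j, -, rfl⟩ := hv.exists_pow_eq'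
  obtain ⟨l, hl2, hlk⟩ := Nat.chineseRemainder (Nat.coprime_two_left.2 hodd) i j
  exact ⟨l, pow_apply_eq_pow_apply_of_modEq ha hl2, pow_apply_eq_pow_apply_of_modEq hx hlk⟩

theorem eq_or_eq_apply_of_sameCycle {α : Type*} [Finite α] {σ : Equiv.Perm α} {a u : α}
    (ha : (σ ^ 2) a = a) (hu : σ.SameCycle a u) : u = a ∨ u = σ a := by
  obtain ⟨i, -, rfl⟩ := hu.exists_pow_eq'
  rcases Nat.mod_two_eq_zero_or_one i with hi | hi
  · exact Or.inl (pow_apply_eq_pow_apply_of_modEq (j := 0) ha hi)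
  · exact Or.inr (pow_apply_eq_pow_apply_of_modEq (j := 1) ha hi)

/-- The pairs consisting of consecutive elements of the long cycle, the pairs meeting both cycles,
and the pair given by the short cycle are the cycles of lengths `k`, `2 * k` and `1` of the
permutation of pairs; the remaining cycles have odd length. -/
theorem exists_PPoly_eq {n k : ℕ} {σ : Equiv.Perm (Fin n)} {x a : Fin n}
    (hodd : Odd k) (hk : 3 ≤ k)
    (hx : ∀ i, (σ ^ i) x = x ↔ k ∣ i) (ha : ∀ i, (σ ^ i) a = a ↔ 2 ∣ i)
    (hax : ¬ σ.SameCycle a x) (hcover : ∀ y, σ.SameCycle x y ∨ σ.SameCycle a y) :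
    ∃ R : ℂ[X], R.eval (-1) ≠ 0 ∧
      PPoly σ = (X ^ k - 1) * ((X ^ (2 * k) - 1) * ((X - 1) * R)) := by
  classical
  have hσx : x ≠ σ x := fun h => by
    have := Nat.le_of_dvd one_pos ((hx 1).1 (by simpa using h.symm))
    omega
  have hσa : a ≠ σ a := fun h => by
    have := (ha 1).1 (by simpa using h.symm)
    omega
  have hne : a ≠ x := fun h => hax (h ▸ SameCycle.refl _ _)
  have hxk : (σ ^ k) x = x := (hx k).2 dvd_rfl
  have ha2 : (σ ^ 2) a = a := (ha 2).2 dvd_rfl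
  have hcomm (i : ℕ) (y : Fin n) : (σ ^ i) (σ y) = σ ((σ ^ i) y) := by
    rw [← mul_apply, ← mul_apply, ← pow_succ, pow_succ']
  set f := pairsPerm σ with hf
  have h₁ : cycleCard f (Quotient.mk _ (finsetPair x (σ x) hσx)) = k := by
    refine cycleCard_mk_eq fun i => ?_
    rw [pairsPerm_pow_finsetPair, finsetPair_eq_iff, ← hx i, hcomm]
    refine ⟨?_, fun h => Or.inl ⟨h, congrArg σ h⟩⟩
    rintro (h | ⟨h, h'⟩)
    · exact h.1
    · rw [h] at h'
      have := Nat.le_of_dvd two_pos ((hx 2).1 (by simpa [pow_two] using h'))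
      omega
  have h₂ : cycleCard f (Quotient.mk _ (finsetPair a x hne)) = 2 * k := by
    refine cycleCard_mk_eq fun i => ?_
    rw [pairsPerm_pow_finsetPair, finsetPair_eq_iff, ha, hx]
    refine ⟨?_, fun h => Or.inl ⟨(dvd_mul_right 2 k).trans h, (dvd_mul_left k 2).trans h⟩⟩
    rintro (h | h)
    · exact (Nat.coprime_two_left.2 hodd).mul_dvd_of_dvd_of_dvd h.1 h.2
    · exact absurd ⟨i, by simpa using h.1⟩ hax
  have h₃ : cycleCard f (Quotient.mk _ (finsetPair a (σ a) hσa)) = 1 := by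
    refine cycleCard_mk_eq fun i => ?_
    simp only [one_dvd, iff_true]
    refine pow_apply_eq_self_of_apply_eq_self ?_ i
    rw [← pow_one f, pairsPerm_pow_finsetPair, finsetPair_eq_iff]
    exact Or.inr ⟨by simp, by simpa [pow_two] using ha2⟩
  set q₁ : Quotient (SameCycle.setoid f) := Quotient.mk _ (finsetPair x (σ x) hσx)
  set q₂ : Quotient (SameCycle.setoid f) := Quotient.mk _ (finsetPair a x hne) with hq₂
  set q₃ : Quotient (SameCycle.setoid f) := Quotient.mk _ (finsetPair a (σ a) hσa) with hq₃
  have h₁₂ : q₁ ≠ q₂ := fun h => by rw [h] at h₁; omega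
  have h₁₃ : q₁ ≠ q₃ := fun h => by rw [h] at h₁; omega
  have h₂₃ : q₂ ≠ q₃ := fun h => by rw [h] at h₂; omega
  have hrest (q : Quotient (SameCycle.setoid f)) (hq₂' : q ≠ q₂) (hq₃' : q ≠ q₃) :
      Odd (cycleCard f q) := by
    induction q using Quotient.inductionOn with | h s => ?_
    obtain ⟨s, hs⟩ := s
    obtain ⟨u, v, huv, rfl⟩ := Finset.card_eq_two.1 hs
    change Quotient.mk _ (finsetPair u v huv) ≠ _ at hq₂' hq₃'
    change Odd (cycleCard f (Quotient.mk _ (finsetPair u v huv)))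
    have hmixed {l : ℕ} (h : (σ ^ l) a = u ∧ (σ ^ l) x = v ∨ (σ ^ l) a = v ∧ (σ ^ l) x = u) :
        Quotient.mk (SameCycle.setoid f) (finsetPair u v huv) = q₂ := by
      rw [hq₂, eq_comm, mk_sameCycle_eq_iff]
      exact ⟨l, by rwa [zpow_natCast, pairsPerm_pow_finsetPair, finsetPair_eq_iff]⟩
    have hfix {y : Fin n} (hy : σ.SameCycle x y) : (σ ^ k) y = y := by
      obtain ⟨i, -, rfl⟩ := hy.exists_pow_eq'
      rw [← mul_apply, ← pow_add, add_comm, pow_add, mul_apply, hxk]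
    rcases hcover u with hu | hu <;> rcases hcover v with hv | hv
    · refine hodd.of_dvd_nat ((pow_apply_eq_self_iff_cycleCard_dvd _ _ _).1 ?_)
      rw [pairsPerm_pow_finsetPair, finsetPair_eq_iff]
      exact Or.inl ⟨hfix hu, hfix hv⟩
    · obtain ⟨l, h⟩ := exists_pow_apply_eq_and_pow_apply_eq hodd hxk ha2 hv hu
      exact absurd (hmixed (Or.inr h)) hq₂'
    · obtain ⟨l, h⟩ := exists_pow_apply_eq_and_pow_apply_eq hodd hxk ha2 hu hv
      exact absurd (hmixed (Or.inl h)) hq₂'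
    · refine absurd (congrArg _ (finsetPair_eq_iff.2 ?_)) hq₃'
      have hu := eq_or_eq_apply_of_sameCycle ha2 hu
      have hv := eq_or_eq_apply_of_sameCycle ha2 hv
      grind
  refine ⟨∏ q ∈ ((Finset.univ.erase q₁).erase q₂).erase q₃, (X ^ cycleCard f q - 1), ?_, ?_⟩
  · rw [eval_prod, Finset.prod_ne_zero_iff]
    intro q hq
    simp only [Finset.mem_erase, Finset.mem_univ, and_true] at hq
    simp only [eval_sub, eval_pow, eval_X, eval_one, (hrest q hq.2.1 hq.1).neg_one_pow]
    norm_num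
  · rw [PPoly, charpoly_permMatrix, ← Finset.mul_prod_erase _ _ (Finset.mem_univ q₁),
      ← Finset.mul_prod_erase _ _ (show q₂ ∈ Finset.univ.erase q₁ by simp [h₁₂.symm]),
      ← Finset.mul_prod_erase _ _
        (show q₃ ∈ (Finset.univ.erase q₁).erase q₂ by simp [h₁₃.symm, h₂₃.symm]),
      h₁, h₂, h₃, pow_one]

/-- For odd `n ≥ 5` and `σ ∈ S_n` of cycle type `(n-2,2)`, the multiplicity of `-1` as a
root of `P_σ(X)` equals that of `m_σ(X)` (both equal `1`); consequently the characteristic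
polynomial `P_σ/m_σ` of `σ` on the Specht module `S^{(n-2,2)}` does not vanish at `-1`
(so `S^{(2²,1^{n-4})}` is not unisingular for odd `n`). -/
theorem not_unisingular_odd_case (n : ℕ) (hn : 5 ≤ n) (hodd : Odd n)
    (σ : Equiv.Perm (Fin n)) (hσ : σ.cycleType = {n - 2, 2}) :
    (PPoly σ).rootMultiplicity (-1) = (mPoly σ).rootMultiplicity (-1) ∧
    (PPoly σ).rootMultiplicity (-1) = 1 ∧
    ¬ (PPoly σ / mPoly σ).IsRoot (-1) := by
  have hk : Odd (n - 2) := Nat.Odd.sub_even (by omega) hodd even_two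
  obtain ⟨x, a, hx, ha, hax, hcover⟩ :=
    exists_of_cycleType_eq_pair hσ (by grind) (by simp; omega)
  obtain ⟨R, hR, hP⟩ := exists_PPoly_eq hk (by omega) hx ha hax hcover
  have hm := mPoly_eq hx ha hax hcover
  generalize n - 2 = k at hk hP hm
  set A : ℂ[X] := (X ^ k - 1) * (X - 1) with hA
  set G : ℂ[X] := ∑ i ∈ Finset.range k, (-X) ^ i with hG
  have hXG : (X + 1) * G = X ^ k + 1 := by
    have h := mul_neg_geom_sum (-X : ℂ[X]) k
    rw [hk.neg_pow] at h
    linear_combination h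
  have hk0 : (k : ℂ) ≠ 0 := Nat.cast_ne_zero.2 hk.pos.ne'
  have hGe : G.eval (-1) ≠ 0 := by simpa [hG, eval_finsetSum] using hk0
  have hX : (X ^ k - 1 : ℂ[X]).eval (-1) ≠ 0 := by
    simp only [eval_sub, eval_pow, eval_X, eval_one, hk.neg_one_pow]
    norm_num
  have hAe : A.eval (-1) ≠ 0 := by
    rw [hA, eval_mul]
    refine mul_ne_zero hX ?_
    simp only [eval_sub, eval_X, eval_one]
    norm_num
  set Q : ℂ[X] := (X ^ k - 1) * G * R with hQ
  have hQe : Q.eval (-1) ≠ 0 := by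
    rw [hQ, eval_mul, eval_mul]
    exact mul_ne_zero (mul_ne_zero hX hGe) hR
  have hmA : mPoly σ = (X - C (-1)) ^ 1 * A := by
    rw [hm, hA, C_neg, C_1]
    ring
  have hPQ : PPoly σ = mPoly σ * Q := by
    rw [hP, hm, hQ, pow_mul', pow_two]
    linear_combination (-(X ^ k - 1) ^ 2 * (X - 1) * R) * hXG
  have hm0 : mPoly σ ≠ 0 := (Matrix.charpoly_monic _).ne_zero
  have hP0 : PPoly σ ≠ 0 := (Matrix.charpoly_monic _).ne_zero
  have hmult : (mPoly σ).rootMultiplicity (-1) = 1 := by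
    rw [hmA, rootMultiplicity_mul (hmA ▸ hm0), rootMultiplicity_X_sub_C_pow,
      rootMultiplicity_eq_zero hAe]
  have hPm : (PPoly σ).rootMultiplicity (-1) = (mPoly σ).rootMultiplicity (-1) := by
    rw [hPQ, rootMultiplicity_mul (hPQ ▸ hP0), rootMultiplicity_eq_zero hQe, add_zero]
  refine ⟨hPm, hPm.trans hmult, ?_⟩
  rw [hPQ, mul_div_cancel_left₀ Q hm0]
  exact hQe
end

section
/- Let n ≥ 2, σ ∈ S_n, and let i be an even element of the multiset cycleType σ (so i ≥ 2 is the length of an even cycle of σ). Then (X^i − 1)^{i/2 − 1} · (X^{i/2} − 1) divides P_σ(X) in ℂ[X]. -/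
open Polynomial

open Matrix in
/-- If `τ` is equivariantly embedded in `π`, then its permutation matrix is a diagonal block. -/
theorem charpoly_permMatrix_dvd_of_injective {R α β : Type*} [CommRing R]
    [Fintype α] [DecidableEq α] [Fintype β] [DecidableEq β]
    {π : Equiv.Perm α} {τ : Equiv.Perm β} {f : β → α} (hf : Function.Injective f)
    (h : ∀ b, π (f b) = f (τ b)) :
    (τ.permMatrix R).charpoly ∣ (π.permMatrix R).charpoly := by
  classical
  let e : β ⊕ ((Set.range f)ᶜ : Set α) ≃ α :=
    ((Equiv.ofInjective f hf).sumCongr (Equiv.refl _)).trans (Equiv.Set.sumCompl (Set.range f))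
  have hel (b : β) : e (Sum.inl b) = f b := by simp [e]
  have her (c : ((Set.range f)ᶜ : Set α)) : e (Sum.inr c) = c := by simp [e]
  rw [← charpoly_reindex e.symm (π.permMatrix R)]
  set M := reindex e.symm e.symm (π.permMatrix R) with hM
  have h₁₁ : M.toBlocks₁₁ = τ.permMatrix R := by
    ext b b'
    simp [hM, toBlocks₁₁, Equiv.Perm.permMatrix, PEquiv.toMatrix_apply, hel, h, hf.eq_iff]
  have h₁₂ : M.toBlocks₁₂ = 0 := by
    ext b c
    have hc : f (τ b) ≠ c := fun hbc => c.2 ⟨_, hbc⟩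
    simp [hM, toBlocks₁₂, Equiv.Perm.permMatrix, PEquiv.toMatrix_apply, hel, her, h, hc]
  rw [← fromBlocks_toBlocks M, h₁₁, h₁₂, charpoly_fromBlocks_zero₁₂]
  exact dvd_mul_right _ _

/-- The powers of a `k`-th root of unity form an eigenvector of the rotation of `Fin k`. -/
theorem X_pow_sub_one_dvd_charpoly_finRotate (k : ℕ) [NeZero k] :
    (X : ℂ[X]) ^ k - 1 ∣ ((finRotate k).permMatrix ℂ).charpoly := by
  have hk : (k : ℂ) ≠ 0 := NeZero.ne _
  have hsep := X_pow_sub_one_separable_iff.2 hk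
  refine (IsAlgClosed.splits _).dvd_of_roots_le_roots hsep.ne_zero
    ((Multiset.le_iff_subset (nodup_roots hsep)).2 fun ζ hζ => ?_)
  have hζ : ζ ^ k = 1 := by
    have := (mem_roots'.1 hζ).2
    simpa [sub_eq_zero] using this
  refine (mem_roots (Matrix.charpoly_monic _).ne_zero).2 ?_
  rw [IsRoot, Matrix.eval_charpoly, ← Matrix.exists_mulVec_eq_zero_iff]
  refine ⟨fun j => ζ ^ (j : ℕ), fun h0 => ?_, ?_⟩
  · simpa using congrFun h0 0
  · rw [Matrix.sub_mulVec, Matrix.permMatrix_mulVec]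
    ext j
    have hj : ((finRotate k j : Fin k) : ℕ) = (j + 1) % k := by
      simp [Fin.val_add]
    have hpow : ζ ^ ((finRotate k j : Fin k) : ℕ) = ζ * ζ ^ (j : ℕ) := by
      rw [hj, ← pow_eq_pow_mod _ hζ, pow_succ']
    simpa [sub_eq_zero] using hpow.symm

theorem charpoly_permMatrix_sigmaCongrRight {R : Type*} [CommRing R] {ι : Type*} [Fintype ι]
    [LinearOrder ι] {β : ι → Type*} [∀ s, Fintype (β s)] [∀ s, DecidableEq (β s)]
    (τ : ∀ s, Equiv.Perm (β s)) :
    ((Equiv.Perm.sigmaCongrRight τ).permMatrix R).charpoly =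
      ∏ s, ((τ s).permMatrix R).charpoly := by
  set M := (Equiv.Perm.sigmaCongrRight τ).permMatrix R with hM
  have hblock : M.BlockTriangular Sigma.fst := by
    rintro ⟨s, b⟩ ⟨t, c⟩ hlt
    simp [hM, Equiv.Perm.permMatrix, PEquiv.toMatrix_apply, Equiv.Perm.sigmaCongrRight, hlt.ne']
  rw [Matrix.charpoly, hblock.charmatrix.det_fintype]
  refine Finset.prod_congr rfl fun s _ => ?_
  rw [← Matrix.charmatrix_toSquareBlock, ← Matrix.charpoly,
    ← Matrix.charpoly_reindex (Equiv.sigmaSubtype s)]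
  congr 1
  ext b c
  simp [hM, Equiv.Perm.permMatrix, PEquiv.toMatrix_apply, Equiv.Perm.sigmaCongrRight,
    Matrix.toSquareBlock, Matrix.toSquareBlockProp, Equiv.sigmaSubtype]

/-- A family of disjoint cycles of `π` of lengths `k s` contributes `∏ s, (X ^ k s - 1)`. -/
theorem prod_X_pow_sub_one_dvd_charpoly_permMatrix {α ι : Type*} [Fintype α] [DecidableEq α]
    [Fintype ι] [LinearOrder ι] {k : ι → ℕ} [∀ s, NeZero (k s)] {π : Equiv.Perm α}
    {f : (Σ s, Fin (k s)) → α} (hf : Function.Injective f)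
    (h : ∀ s j, π (f ⟨s, j⟩) = f ⟨s, finRotate (k s) j⟩) :
    ∏ s, ((X : ℂ[X]) ^ k s - 1) ∣ (π.permMatrix ℂ).charpoly :=
  calc ∏ s, ((X : ℂ[X]) ^ k s - 1)
      ∣ ∏ s, ((finRotate (k s)).permMatrix ℂ).charpoly :=
        Finset.prod_dvd_prod_of_dvd _ _ fun s _ => X_pow_sub_one_dvd_charpoly_finRotate (k s)
    _ = _ := (charpoly_permMatrix_sigmaCongrRight _).symm
    _ ∣ _ := charpoly_permMatrix_dvd_of_injective hf fun ⟨s, j⟩ => h s j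

theorem Equiv.Perm.exists_pow_apply_eq_iff_of_mem_cycleType {α : Type*} [Fintype α]
    [DecidableEq α] {σ : Equiv.Perm α} {i : ℕ} (hi : i ∈ σ.cycleType) :
    ∃ a, ∀ x y : ℕ, (σ ^ x) a = (σ ^ y) a ↔ x ≡ y [MOD i] := by
  rw [cycleType_def, Multiset.mem_map] at hi
  obtain ⟨c, hc, rfl⟩ := hi
  have hcyc := (mem_cycleFactorsFinset_iff.1 hc).1
  obtain ⟨a, ha⟩ := hcyc.nonempty_support
  have hca (x : ℕ) : (σ ^ x) a = (c ^ x) a := by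
    rw [cycle_is_cycleOf ha hc, cycleOf_pow_apply_self]
  have hfix (x : ℕ) : (c ^ x) a = a ↔ c.support.card ∣ x := by
    rw [← hcyc.pow_eq_one_iff' (mem_support.1 ha), ← hcyc.orderOf, orderOf_dvd_iff_pow_eq_one]
  have hle (x y : ℕ) (hxy : x ≤ y) : (c ^ x) a = (c ^ y) a ↔ x ≡ y [MOD c.support.card] := by
    obtain ⟨z, rfl⟩ := Nat.exists_eq_add_of_le hxy
    rw [pow_add, mul_apply, (c ^ x).injective.eq_iff, eq_comm, hfix,
      Nat.modEq_iff_dvd' hxy, Nat.add_sub_cancel_left]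
  refine ⟨a, fun x y => ?_⟩
  rw [hca, hca]
  rcases le_total x y with hxy | hxy
  · exact hle x y hxy
  · exact eq_comm.trans ((hle y x hxy).trans Nat.ModEq.comm)

/-- For `n ≥ 2`, `σ ∈ S_n` and an even part `i` of the cycle type of `σ`,
`(X^i - 1)^{i/2 - 1} · (X^{i/2} - 1)` divides `P_σ(X)` in `ℂ[X]`. -/
theorem even_part_dvd_PPoly (n : ℕ) (hn : 2 ≤ n) (σ : Equiv.Perm (Fin n)) (i : ℕ)
    (hi : i ∈ σ.cycleType) (hieven : Even i) :
    ((X : ℂ[X]) ^ i - 1) ^ (i / 2 - 1) * ((X : ℂ[X]) ^ (i / 2) - 1) ∣ PPoly σ := by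
  obtain ⟨a, ha⟩ := Equiv.Perm.exists_pow_apply_eq_iff_of_mem_cycleType hi
  have hi2 := Equiv.Perm.two_le_of_mem_cycleType hi
  obtain ⟨m, rfl⟩ : ∃ m, i = 2 * (m + 1) := by
    obtain ⟨r, hr⟩ := hieven
    exact ⟨r - 1, by omega⟩
  have hper (x : ℕ) : (σ ^ (x + 2 * (m + 1))) a = (σ ^ x) a := (ha _ _).2 (by simp [Nat.ModEq])
  have hclose {x y : ℕ} (hxy : (σ ^ x) a = (σ ^ y) a) (hx : x < 4 * (m + 1))
      (hy : y < 4 * (m + 1)) : x = y ∨ x + 2 * (m + 1) = y ∨ y + 2 * (m + 1) = x := by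
    have hmod : x % (2 * (m + 1)) = y % (2 * (m + 1)) := (ha x y).1 hxy
    have hreduce (z : ℕ) (hz : z < 4 * (m + 1)) :
        z = z % (2 * (m + 1)) ∨ z = z % (2 * (m + 1)) + 2 * (m + 1) := by
      rcases lt_or_ge z (2 * (m + 1)) with h | h
      · exact .inl (Nat.mod_eq_of_lt h).symm
      · rw [Nat.mod_eq_sub_mod h, Nat.mod_eq_of_lt (by omega)]
        omega
    rcases hreduce x hx with h | h <;> rcases hreduce y hy with h' | h' <;> omega
  let k : Fin (m + 1) → ℕ := fun s => if (s : ℕ) = m then m + 1 else 2 * (m + 1)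
  have hk (s : Fin (m + 1)) : ((s : ℕ) = m ∧ k s = m + 1) ∨ ((s : ℕ) < m ∧ k s = 2 * (m + 1)) := by
    have := s.2
    by_cases h : (s : ℕ) = m
    · exact .inl ⟨h, if_pos h⟩
    · exact .inr ⟨by omega, if_neg h⟩
  have (s : Fin (m + 1)) : NeZero (k s) := ⟨by have := hk s; omega⟩
  let f : (Σ s, Fin (k s)) → {s : Finset (Fin n) // s.card = 2} := fun p =>
    ⟨{(σ ^ (p.2 : ℕ)) a, (σ ^ (p.2 + p.1 + 1 : ℕ)) a}, Finset.card_pair fun h => by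
      have := hk p.1
      have := p.2.2
      have := hclose h (by omega) (by omega)
      omega⟩
  have hf : Function.Injective f := by
    rintro ⟨s, j⟩ ⟨t, l⟩ h
    have hs := hk s
    have ht := hk t
    have hj := j.2
    have hl := l.2
    have hset : ({(σ ^ (j : ℕ)) a, (σ ^ (j + s + 1 : ℕ)) a} : Set (Fin n)) =
        {(σ ^ (l : ℕ)) a, (σ ^ (l + t + 1 : ℕ)) a} := by
      simpa [f] using congrArg (fun u : Finset (Fin n) => (u : Set (Fin n))) (Subtype.ext_iff.1 h)
    have hst : (s : ℕ) = t ∧ (j : ℕ) = l := by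
      rcases Set.pair_eq_pair_iff.1 hset with ⟨h₁, h₂⟩ | ⟨h₁, h₂⟩ <;>
      · have := hclose h₁ (by omega) (by omega)
        have := hclose h₂ (by omega) (by omega)
        omega
    obtain rfl : s = t := Fin.ext hst.1
    obtain rfl : j = l := Fin.ext hst.2
    rfl
  have hrot (s) (j : Fin (k s)) : pairsPerm σ (f ⟨s, j⟩) = f ⟨s, finRotate (k s) j⟩ := by
    have hval : ((finRotate (k s) j : Fin (k s)) : ℕ) = (j + 1) % k s := by
      simp [Fin.val_add]
    apply Subtype.ext
    have hl : ((pairsPerm σ (f ⟨s, j⟩) : {s : Finset (Fin n) // s.card = 2}) : Finset (Fin n)) =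
        {(σ ^ (j + 1 : ℕ)) a, (σ ^ (j + s + 1 + 1 : ℕ)) a} := by
      simp [pairsPerm, f, pow_succ' σ, Finset.map_insert]
    have hr : (f ⟨s, finRotate (k s) j⟩ : Finset (Fin n)) =
        {(σ ^ ((j + 1) % k s : ℕ)) a, (σ ^ ((j + 1) % k s + s + 1 : ℕ)) a} := by
      simp only [f, hval]
    rw [hl, hr]
    rcases Nat.lt_or_ge (j + 1) (k s) with hlt | hge
    · rw [Nat.mod_eq_of_lt hlt, show (j : ℕ) + s + 1 + 1 = j + 1 + s + 1 by omega]
    · have hjk : (j : ℕ) + 1 = k s := by omega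
      rw [hjk, Nat.mod_self]
      rcases hk s with ⟨hs, hks⟩ | ⟨hs, hks⟩
      · rw [show (j : ℕ) + s + 1 + 1 = 0 + 2 * (m + 1) by omega, hper, hks,
          show 0 + (s : ℕ) + 1 = m + 1 by omega, Finset.pair_comm]
      · rw [show (j : ℕ) + s + 1 + 1 = 0 + s + 1 + 2 * (m + 1) by omega, hper,
          show k s = 0 + 2 * (m + 1) by omega, hper]
  have hdvd := prod_X_pow_sub_one_dvd_charpoly_permMatrix hf hrot
  have hlast : k (Fin.last m) = m + 1 := if_pos rfl
  have hinit (s : Fin m) : k s.castSucc = 2 * (m + 1) := if_neg s.2.ne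
  rw [Fin.prod_univ_castSucc, hlast] at hdvd
  simp only [hinit, Finset.prod_const, Finset.card_univ, Fintype.card_fin] at hdvd
  rwa [Nat.mul_div_cancel_left _ two_pos, Nat.add_sub_cancel]
end

section
/- Let n ≥ 2, σ ∈ S_n, and let i be an odd element of the multiset cycleType σ (so i ≥ 3 is the length of an odd cycle of σ). Then (X^i − 1)^{(i−1)/2} divides P_σ(X) in ℂ[X]. -/
open Polynomial

/-- If the permutation `τ` acts on the range of an injection `f : ZMod i × β → α` by shifting the
first coordinate, then every `i`-th root of unity is a root of the characteristic polynomial of its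
permutation matrix, of multiplicity at least the cardinality of `β`. -/
lemma card_le_rootMultiplicity_charpoly_permMatrix {α β K : Type*} [Fintype α] [DecidableEq α]
    [Fintype β] [Field K] {i : ℕ} [NeZero i] (τ : Equiv.Perm α) (f : ZMod i × β → α)
    (hf : Function.Injective f) (hτ : ∀ a b, τ (f (a, b)) = f (a + 1, b)) {ζ : K}
    (hζ : ζ ^ i = 1) :
    Fintype.card β ≤ (τ.permMatrix K).charpoly.rootMultiplicity ζ := by
  have hval (a : ZMod i) : ζ ^ (a + 1).val = ζ * ζ ^ a.val := by
    rw [← pow_succ', ZMod.val_add, ← pow_eq_pow_mod _ hζ, ZMod.val_one_eq_one_mod, pow_add,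
      ← pow_eq_pow_mod _ hζ, pow_add]
  let L : (β → K) →ₗ[K] α → K := Function.ExtendByZero.linearMap K f ∘ₗ
    LinearMap.pi fun p : ZMod i × β => ζ ^ p.1.val • LinearMap.proj p.2
  have hL (c : β → K) (a : ZMod i) (b : β) : L c (f (a, b)) = ζ ^ a.val * c b := by
    simp [L, hf.extend_apply]
  have hL0 (c : β → K) (x : α) (hx : x ∉ Set.range f) : L c x = 0 := by
    simpa [L] using Function.extend_apply' (f := f) _ (0 : α → K) x hx
  have hmem (c : β → K) :
      L c ∈ Module.End.eigenspace (Matrix.toLin' (τ.permMatrix K)) ζ := by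
    rw [Module.End.mem_eigenspace_iff, Matrix.toLin'_apply, Matrix.permMatrix_mulVec]
    funext x
    by_cases hx : x ∈ Set.range f
    · obtain ⟨⟨a, b⟩, rfl⟩ := hx
      simp [hτ, hL, hval, mul_assoc]
    · have hx' : τ x ∉ Set.range f := by
        rintro ⟨⟨a, b⟩, h⟩
        refine hx ⟨(a - 1, b), τ.injective ?_⟩
        rw [hτ, sub_add_cancel, h]
      simp [hL0 c x hx, hL0 c _ hx']
  have hinj : Function.Injective (L.codRestrict _ hmem) := by
    intro c d h
    funext b
    have := congrFun (congrArg Subtype.val h) (f (0, b))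
    simpa [hL] using this
  have := LinearMap.finrank_le_finrank_of_injective hinj
  rw [Module.finrank_fintype_fun_eq_card] at this
  refine this.trans ?_
  rw [← Matrix.charpoly_toLin']
  exact LinearMap.finrank_eigenspace_le _ ζ

/-- If every `i`-th root of unity is a root of `p` of multiplicity at least `k`, then
`(X ^ i - 1) ^ k` divides `p`. -/
lemma X_pow_sub_one_pow_dvd {p : ℂ[X]} {i k : ℕ} (hi : i ≠ 0)
    (h : ∀ ζ : ℂ, ζ ^ i = 1 → k ≤ p.rootMultiplicity ζ) : ((X : ℂ[X]) ^ i - 1) ^ k ∣ p := by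
  rw [X_pow_sub_one_eq_prod (Nat.pos_of_ne_zero hi) (Complex.isPrimitiveRoot_exp i hi),
    ← Finset.prod_pow]
  refine Finset.prod_dvd_of_coprime (fun a _ b _ hab => ?_) fun ζ hζ => ?_
  · exact (isCoprime_X_sub_C_of_isUnit_sub (sub_ne_zero.2 hab).isUnit).pow
  · exact (pow_dvd_pow _ (h ζ ((mem_nthRootsFinset (Nat.pos_of_ne_zero hi) _).1 hζ))).trans
      (pow_rootMultiplicity_dvd p ζ)

/-- The elements of a cycle of length `i` can be indexed by `ZMod i`. -/
lemma exists_injective_zmod_of_mem_cycleType {α : Type*} [Fintype α] [DecidableEq α]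
    {σ : Equiv.Perm α} {i : ℕ} [NeZero i] (hi : i ∈ σ.cycleType) :
    ∃ e : ZMod i → α, Function.Injective e ∧ ∀ a, σ (e a) = e (a + 1) := by
  rw [Equiv.Perm.cycleType_def, Multiset.mem_map] at hi
  obtain ⟨c, hc, rfl⟩ := hi
  rw [Finset.mem_val] at hc
  simp only [Function.comp_apply] at *
  have hcyc := Equiv.Perm.isCycleOn_support_of_mem_cycleFactorsFinset hc
  obtain ⟨x, hx⟩ := (Equiv.Perm.mem_cycleFactorsFinset_iff.1 hc).1.nonempty_support
  refine ⟨fun a => (σ ^ a.val) x, fun a b h => ?_, fun a => ?_⟩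
  · have := (hcyc.pow_apply_eq_pow_apply hx).1 h
    exact ZMod.val_injective _ (this.eq_of_lt_of_lt a.val_lt b.val_lt)
  · rw [← Equiv.Perm.mul_apply, ← pow_succ', hcyc.pow_apply_eq_pow_apply hx]
    refine (ZMod.natCast_eq_natCast_iff _ _ _).1 ?_
    simp

/-- For `n ≥ 2`, `σ ∈ S_n` and an odd part `i` of the cycle type of `σ`,
`(X^i - 1)^{(i-1)/2}` divides `P_σ(X)` in `ℂ[X]`. -/
theorem odd_part_dvd_PPoly (n : ℕ) (hn : 2 ≤ n) (σ : Equiv.Perm (Fin n)) (i : ℕ)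
    (hi : i ∈ σ.cycleType) (hiodd : Odd i) :
    ((X : ℂ[X]) ^ i - 1) ^ ((i - 1) / 2) ∣ PPoly σ := by
  have : NeZero i := ⟨by rintro rfl; simp at hiodd⟩
  obtain ⟨e, he, hσ⟩ := exists_injective_zmod_of_mem_cycleType hi
  have hcast (m : ℕ) (h0 : 0 < m) (hm : m < i) : (m : ZMod i) ≠ 0 := by
    rw [Ne, ZMod.natCast_eq_zero_iff]
    exact Nat.not_dvd_of_pos_of_lt h0 hm
  have hne (a : ZMod i) (b : Fin ((i - 1) / 2)) : e a ≠ e (a + (b.val + 1 : ℕ)) := by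
    refine he.ne fun h => hcast (b.val + 1) (by omega) (by omega) ?_
    simpa using h
  let f : ZMod i × Fin ((i - 1) / 2) → {s : Finset (Fin n) // s.card = 2} := fun p =>
    ⟨{e p.1, e (p.1 + (p.2.val + 1 : ℕ))}, Finset.card_pair (hne _ _)⟩
  have hf : Function.Injective f := by
    rintro ⟨a, b⟩ ⟨a', b'⟩ h
    have h := congrArg (fun s => (s.1 : Set (Fin n))) h
    simp only [f, Finset.coe_pair, Set.pair_eq_pair_iff, he.eq_iff] at h
    obtain ⟨rfl, h⟩ | ⟨h, h'⟩ := h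
    · have h := (ZMod.natCast_eq_natCast_iff _ _ _).1 (add_left_cancel h)
      have := h.eq_of_lt_of_lt (by omega) (by omega)
      rw [Prod.mk.injEq, Fin.ext_iff]
      exact ⟨rfl, by omega⟩
    · refine absurd ?_ (hcast (b.val + 1 + (b'.val + 1)) (by omega) (by omega))
      rw [h, add_assoc, ← Nat.cast_add, add_comm (b'.val + 1)] at h'
      simpa using h'
  refine X_pow_sub_one_pow_dvd (NeZero.ne i) fun ζ hζ => ?_
  have := card_le_rootMultiplicity_charpoly_permMatrix (pairsPerm σ) f hf
    (fun a b => ?_) hζ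
  · simpa [PPoly] using this
  · refine Subtype.ext ?_
    simp [pairsPerm, f, hσ, add_right_comm, Finset.map_insert]
end

section
/- Let m be an odd positive integer, let n = 2m, and let σ ∈ S_n be a product of m disjoint transpositions, i.e. cycleType σ is the multiset consisting of m copies of 2. Then P_σ(X) = (X − 1)^m · (X² − 1)^{m² − m}. -/
open Polynomial

open Equiv in
/-- The characteristic polynomial of the permutation matrix of an involution with `f` fixed points
and `k` transpositions. -/
theorem charpoly_permMatrix_of_sq_eq_one {α : Type*} [Fintype α] [DecidableEq α] (τ : Perm α)
    (hτ : τ ^ 2 = 1) {f k : ℕ} (hf : (Function.fixedPoints τ).ncard = f)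
    (hcard : Fintype.card α = f + 2 * k) :
    (τ.permMatrix ℂ).charpoly = (X - 1) ^ f * (X ^ 2 - 1) ^ k := by
  set A := τ.permMatrix ℂ with hA
  have hA2 : A ^ 2 = 1 := by
    rw [sq, hA, ← Matrix.permMatrix_mul, ← sq, hτ, Matrix.permMatrix_one]
  have hroot : ∀ μ ∈ A.charpoly.roots, μ = 1 ∨ μ = -1 := by
    intro μ hμ
    have h1 := Matrix.mem_spectrum_of_isRoot_charpoly (isRoot_of_mem_roots hμ)
    have h2 := spectrum.pow_mem_pow A 2 h1
    cases isEmpty_or_nonempty α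
    · rw [spectrum.of_subsingleton] at h1
      exact h1.elim
    · rw [hA2, spectrum.one_eq] at h2
      exact mul_self_eq_one_iff.1 ((sq μ).symm.trans h2)
  have hsplit : A.charpoly.Splits := IsAlgClosed.splits _
  have hdeg : Multiset.card A.charpoly.roots = f + 2 * k := by
    rw [← hsplit.natDegree_eq_card_roots, Matrix.charpoly_natDegree_eq_dim, hcard]
  have htrace : A.charpoly.roots.sum = f := by
    rw [← Matrix.trace_eq_sum_roots_charpoly, hA, Matrix.trace_permutation, hf]
  have hrep : A.charpoly.roots = Multiset.replicate (A.charpoly.roots.count 1) 1 +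
      Multiset.replicate (A.charpoly.roots.count (-1)) (-1) := by
    ext μ
    rw [Multiset.count_add, Multiset.count_replicate, Multiset.count_replicate]
    by_cases hμ : μ ∈ A.charpoly.roots
    · have : (1 : ℂ) ≠ -1 := by norm_num
      rcases hroot μ hμ with rfl | rfl
      · simp [this.symm]
      · simp [this]
    · rw [Multiset.count_eq_zero.2 hμ]
      split_ifs <;> simp_all
  generalize A.charpoly.roots.count 1 = a at hrep
  generalize A.charpoly.roots.count (-1) = b at hrep
  rw [hrep] at hdeg htrace
  simp only [Multiset.card_add, Multiset.card_replicate, Multiset.sum_add, Multiset.sum_replicate,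
    nsmul_eq_mul, mul_one, mul_neg] at hdeg htrace
  have htrace' : a = f + b := by
    rw [← sub_eq_add_neg, sub_eq_iff_eq_add] at htrace
    exact_mod_cast htrace
  obtain rfl : b = k := by omega
  rw [hsplit.eq_prod_roots_of_monic (Matrix.charpoly_monic A), hrep, htrace']
  simp only [Multiset.map_add, Multiset.map_replicate, Multiset.prod_add, Multiset.prod_replicate,
    map_neg, map_one]
  rw [pow_add, mul_assoc, ← mul_pow]
  ring

/-- A pair fixed by a permutation `σ` without fixed points is of the form `{a, σ a}`. -/
theorem eq_pair_of_pairsPerm_eq {n : ℕ} {σ : Equiv.Perm (Fin n)} (hfix : ∀ a, σ a ≠ a)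
    {s : {s : Finset (Fin n) // s.card = 2}} (hs : pairsPerm σ s = s) {a : Fin n}
    (ha : a ∈ s.1) : s.1 = {a, σ a} := by
  have h : s.1.map σ.toEmbedding = s.1 := congrArg Subtype.val hs
  have hσa : σ a ∈ s.1 := by
    rw [← h]
    exact Finset.mem_map_of_mem _ ha
  refine (Finset.eq_of_subset_of_card_le ?_ ?_).symm
  · simp [Finset.insert_subset_iff, ha, hσa]
  · rw [s.2, Finset.card_pair (hfix a).symm]

theorem pairsPerm_pair {n : ℕ} {σ : Equiv.Perm (Fin n)} (hσ : ∀ a, σ (σ a) = a) (a : Fin n)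
    (h : ({a, σ a} : Finset (Fin n)).card = 2) : pairsPerm σ ⟨{a, σ a}, h⟩ = ⟨{a, σ a}, h⟩ := by
  refine Subtype.ext ?_
  change Finset.map σ.toEmbedding {a, σ a} = {a, σ a}
  simp [Finset.map_insert, hσ, Finset.pair_comm]

theorem pairsPerm_sq {n : ℕ} {σ : Equiv.Perm (Fin n)} (hσ : ∀ a, σ (σ a) = a) :
    pairsPerm σ ^ 2 = 1 := by
  ext s : 2
  change Finset.map σ.toEmbedding (Finset.map σ.toEmbedding s.1) = s.1
  rw [Finset.map_map]
  refine Eq.trans ?_ s.1.map_refl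
  congr 1
  ext a : 1
  exact hσ a

/-- A fixed-point-free involution of `2 * m` points fixes exactly `m` pairs. -/
theorem two_mul_ncard_fixedPoints_pairsPerm {n : ℕ} {σ : Equiv.Perm (Fin n)}
    (hfix : ∀ a, σ a ≠ a) (hσ : ∀ a, σ (σ a) = a) :
    2 * (Function.fixedPoints (pairsPerm σ)).ncard = n := by
  classical
  have h := Finset.sum_card_bipartiteAbove_eq_sum_card_bipartiteBelow
    (s := (Function.fixedPoints (pairsPerm σ)).toFinset) (t := Finset.univ)
    (fun s (a : Fin n) => a ∈ s.1)
  have h1 : ∀ s ∈ (Function.fixedPoints (pairsPerm σ)).toFinset,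
      (Finset.univ.bipartiteAbove (fun s (a : Fin n) => a ∈ s.1) s).card = 2 := by
    intro s _
    simp [Finset.bipartiteAbove, s.2]
  have h2 : ∀ a ∈ (Finset.univ : Finset (Fin n)),
      ((Function.fixedPoints (pairsPerm σ)).toFinset.bipartiteBelow
        (fun s (a : Fin n) => a ∈ s.1) a).card = 1 := by
    intro a _
    refine Finset.card_eq_one.2
      ⟨⟨{a, σ a}, Finset.card_pair (hfix a).symm⟩, Finset.eq_singleton_iff_unique_mem.2 ⟨?_, ?_⟩⟩
    · simp [Finset.bipartiteBelow, Function.IsFixedPt, pairsPerm_pair hσ]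
    · intro s hs
      simp only [Finset.bipartiteBelow, Finset.mem_filter, Set.mem_toFinset] at hs
      exact Subtype.ext (eq_pair_of_pairsPerm_eq hfix hs.1 hs.2)
  rw [Finset.sum_congr rfl h1, Finset.sum_congr rfl h2] at h
  simpa [Set.ncard_eq_toFinset_card', mul_comm] using h

/-- For an odd positive integer `m` and `σ ∈ S_{2m}` a product of `m` disjoint
transpositions, `P_σ(X) = (X - 1)^m · (X² - 1)^{m² - m}`. -/
theorem PPoly_of_m_transpositions (m : ℕ) (hm : 0 < m) (hmodd : Odd m)
    (σ : Equiv.Perm (Fin (2 * m))) (hσ : σ.cycleType = Multiset.replicate m 2) :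
    PPoly σ = ((X : ℂ[X]) - 1) ^ m * ((X : ℂ[X]) ^ 2 - 1) ^ (m ^ 2 - m) := by
  have hsq : σ ^ 2 = 1 := Equiv.Perm.pow_prime_eq_one_iff.2 fun c hc => by
    rw [hσ] at hc
    exact Multiset.eq_of_mem_replicate hc
  have hinv : ∀ a, σ (σ a) = a := fun a => by
    simpa [sq] using Equiv.congr_fun hsq a
  have hsupp : σ.support = Finset.univ := by
    rw [← Finset.card_eq_iff_eq_univ, ← Equiv.Perm.sum_cycleType, hσ]
    simp [mul_comm]
  have hfix : ∀ a, σ a ≠ a := fun a => by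
    rw [← Equiv.Perm.mem_support, hsupp]
    exact Finset.mem_univ a
  refine charpoly_permMatrix_of_sq_eq_one _ (pairsPerm_sq hinv) ?_ ?_
  · have := two_mul_ncard_fixedPoints_pairsPerm hfix hinv
    omega
  · rw [Fintype.card_finset_len, Fintype.card_fin, Nat.choose_two_right]
    obtain ⟨k, rfl⟩ : ∃ k, m = k + 1 := ⟨m - 1, by omega⟩
    have h1 : (k + 1) ^ 2 - (k + 1) = k * (k + 1) := by
      rw [Nat.sub_eq_iff_eq_add (Nat.le_self_pow two_ne_zero _)]
      ring
    rw [h1]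
    refine Nat.div_eq_of_eq_mul_right two_pos ?_
    rw [show 2 * (k + 1) - 1 = 2 * k + 1 by omega]
    ring
end
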